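/- arXiv:2312.09587 — 3 statements merged into one kernel-verified Lean document; each statement's English description precedes it below -/
import Mathlib

section
/- Let κ>0, C>0, T>0, h∈(0,1], l∈(0,1] and c₀,c₁,c₂>0. There exist δ₀>0 and c>0 such that for every δ∈(0,δ₀), every N∈ℕ with N ≤ c₂δ^{−l}, every choice of centers 0 < T₁ < ⋯ < T_N < T with I_j := (T_j−δ/2, T_j+δ/2) ⊂ (0,T) pairwise disjoint and T_{j+1}−T_j ≥ c₁δ^{l}, if the matrix Ā is invertible with ‖Ā⁻¹‖₂ ≤ c₀ and E: ℝ→ℂ is a total field (i.e. a continuous solution of the Lippmann–Schwinger equation), then Σ_{j=1}^N ‖E‖_{L²(I_j)} ≤ c δ^{1/2} N. -/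
open MeasureTheory

/-- The outgoing fundamental solution `Φ_κ(t,s) = (i/(2κ)) e^{iκ|t−s|}` of `d²/dt² + κ²`. -/
noncomputable def Phi (κ t s : ℝ) : ℂ :=
  Complex.I / (2 * κ) * Complex.exp (Complex.I * κ * |t - s|)

/-- The matrix `Ā` with entries `Ā_{mm} = 1 − β`, `Ā_{mj} = −β e^{iκ|T_m−T_j|}` (`m ≠ j`),
where `β = iCδ^{1−h}/(2κ)`. -/
noncomputable def Abar {N : ℕ} (κ C δ h : ℝ) (Tc : Fin N → ℝ) :
    Matrix (Fin N) (Fin N) ℂ :=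
  fun m j => (if m = j then (1 : ℂ) else 0) -
    Complex.I * ((C * δ ^ (1 - h) : ℝ) : ℂ) / (2 * κ) *
      Complex.exp (Complex.I * κ * |Tc m - Tc j|)

/-- A total field: a continuous solution of the Lippmann–Schwinger equation. -/
def IsTotalField (κ C δ h : ℝ) {N : ℕ} (Tc : Fin N → ℝ) (E : ℝ → ℂ) : Prop :=
  Continuous E ∧ ∀ t : ℝ,
    E t - (C * δ ^ (-h) : ℝ) *
        ∑ j, ∫ s in Set.Ioo (Tc j - δ / 2) (Tc j + δ / 2), Phi κ t s * E s
      = Complex.exp (Complex.I * κ * t)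

/-- The operator 2-norm of a matrix, acting on the Euclidean space `ℂᴺ`. -/
noncomputable def l2OpNorm {N : ℕ} (A : Matrix (Fin N) (Fin N) ℂ) : ℝ :=
  ‖Matrix.toEuclideanCLM (𝕜 := ℂ) A‖

/-- The `L²` norm of `E` on the interval `(a,b)`. -/
noncomputable def L2normOn (a b : ℝ) (E : ℝ → ℂ) : ℝ :=
  Real.sqrt (∫ s in Set.Ioo a b, ‖E s‖ ^ 2)

/-- The plane wave `e^{iκx}`. -/
noncomputable def planeWave (κ x : ℝ) : ℂ := Complex.exp (Complex.I * κ * x)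

lemma planeWave_eq (κ x : ℝ) :
    planeWave κ x = (Real.cos (κ * x) : ℂ) + Complex.I * (Real.sin (κ * x) : ℂ) := by
  rw [planeWave, show Complex.I * κ * x = ((κ * x : ℝ) : ℂ) * Complex.I by push_cast; ring,
    Complex.exp_mul_I, ← Complex.ofReal_cos, ← Complex.ofReal_sin]
  ring

lemma planeWave_neg_eq (κ x : ℝ) :
    planeWave κ (-x) = (Real.cos (κ * x) : ℂ) - Complex.I * (Real.sin (κ * x) : ℂ) := by
  rw [planeWave_eq, mul_neg, Real.cos_neg, Real.sin_neg]
  push_cast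
  ring

lemma planeWave_add (κ x y : ℝ) :
    planeWave κ (x + y) = planeWave κ x * planeWave κ y := by
  simp only [planeWave, ← Complex.exp_add]
  congr 1
  push_cast
  ring

@[simp] lemma planeWave_zero (κ : ℝ) : planeWave κ 0 = 1 := by simp [planeWave]

@[simp] lemma norm_planeWave (κ x : ℝ) : ‖planeWave κ x‖ = 1 := by
  rw [planeWave, show Complex.I * κ * x = ((κ * x : ℝ) : ℂ) * Complex.I by push_cast; ring]
  exact Complex.norm_exp_ofReal_mul_I _

@[fun_prop] lemma continuous_planeWave (κ : ℝ) : Continuous (planeWave κ) := by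
  unfold planeWave
  fun_prop

lemma norm_planeWave_sub_one_le (κ x : ℝ) : ‖planeWave κ x - 1‖ ≤ |κ * x| := by
  have := Real.norm_exp_I_mul_ofReal_sub_one_le (x := κ * x)
  rwa [show Complex.I * ((κ * x : ℝ) : ℂ) = Complex.I * κ * x by push_cast; ring,
    Real.norm_eq_abs] at this

lemma norm_planeWave_sub_le (κ x y : ℝ) :
    ‖planeWave κ x - planeWave κ y‖ ≤ |κ * (x - y)| := by
  have h : planeWave κ x - planeWave κ y = planeWave κ y * (planeWave κ (x - y) - 1) := by
    rw [mul_sub, ← planeWave_add, mul_one, add_sub_cancel]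
  rw [h, norm_mul, norm_planeWave, one_mul]
  exact norm_planeWave_sub_one_le _ _

/-- The mean of `f` over the window `(-δ/2, δ/2)`. -/
noncomputable def windowMean (δ : ℝ) (f : ℝ → ℂ) : ℂ :=
  (δ : ℂ)⁻¹ * ∫ v in (-(δ / 2))..(δ / 2), f v

section WindowMean

variable {δ : ℝ} {f g : ℝ → ℂ}

lemma windowMean_add (hf : Continuous f) (hg : Continuous g) :
    windowMean δ (fun v => f v + g v) = windowMean δ f + windowMean δ g := by
  simp only [windowMean]
  rw [intervalIntegral.integral_add (hf.intervalIntegrable _ _) (hg.intervalIntegrable _ _),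
    mul_add]

lemma windowMean_sub (hf : Continuous f) (hg : Continuous g) :
    windowMean δ (fun v => f v - g v) = windowMean δ f - windowMean δ g := by
  simp only [windowMean]
  rw [intervalIntegral.integral_sub (hf.intervalIntegrable _ _) (hg.intervalIntegrable _ _),
    mul_sub]

lemma windowMean_const_mul (c : ℂ) (f : ℝ → ℂ) :
    windowMean δ (fun v => c * f v) = c * windowMean δ f := by
  simp only [windowMean, intervalIntegral.integral_const_mul]
  ring

lemma windowMean_const (hδ : 0 < δ) (c : ℂ) : windowMean δ (fun _ => c) = c := by
  have : (δ : ℂ) ≠ 0 := by exact_mod_cast hδ.ne'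
  simp [windowMean, this]

lemma windowMean_of_odd (hf : ∀ v, f (-v) = -f v) : windowMean δ f = 0 := by
  have h := intervalIntegral.integral_comp_neg (a := -(δ / 2)) (b := δ / 2) f
  simp only [hf, neg_neg, intervalIntegral.integral_neg] at h
  have : (∫ v in (-(δ / 2))..(δ / 2), f v) = 0 := by
    linear_combination (-1 / 2 : ℂ) * h
  simp [windowMean, this]

lemma norm_windowMean_le (hδ : 0 < δ) {K : ℝ} (hf : ∀ v, |v| ≤ δ / 2 → ‖f v‖ ≤ K) :
    ‖windowMean δ f‖ ≤ K := by
  have h : ‖∫ v in (-(δ / 2))..(δ / 2), f v‖ ≤ K * |δ / 2 - -(δ / 2)| := by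
    refine intervalIntegral.norm_integral_le_of_norm_le_const fun v hv => hf v ?_
    rw [Set.uIoc_of_le (by linarith)] at hv
    exact abs_le.2 ⟨hv.1.le, hv.2⟩
  rw [show δ / 2 - -(δ / 2) = δ by ring, abs_of_pos hδ] at h
  rw [windowMean, norm_mul, norm_inv, Complex.norm_real, Real.norm_eq_abs, abs_of_pos hδ,
    inv_mul_le_iff₀ hδ]
  linarith

lemma windowMean_congr (hδ : 0 < δ) (h : ∀ v, |v| ≤ δ / 2 → f v = g v) :
    windowMean δ f = windowMean δ g := by
  unfold windowMean
  congr 1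
  refine intervalIntegral.integral_congr fun v hv => h v ?_
  rw [Set.uIcc_of_le (by linarith)] at hv
  exact abs_le.2 hv

lemma setIntegral_Ioo_eq_windowMean (hδ : 0 < δ) (x : ℝ) (f : ℝ → ℂ) :
    ∫ s in Set.Ioo (x - δ / 2) (x + δ / 2), f s = δ * windowMean δ fun v => f (x + v) := by
  have : (δ : ℂ) ≠ 0 := by exact_mod_cast hδ.ne'
  rw [windowMean, ← mul_assoc, mul_inv_cancel₀ this, one_mul,
    intervalIntegral.integral_comp_add_left, ← integral_Ioc_eq_integral_Ioo,
    ← intervalIntegral.integral_of_le (by linarith), sub_eq_add_neg]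

end WindowMean

/-- The even moment of `F` over the window. -/
noncomputable def cosMoment (κ δ : ℝ) (F : ℝ → ℂ) : ℂ :=
  windowMean δ fun v => (Real.cos (κ * v) : ℂ) * F v

/-- The odd moment of `F` over the window. -/
noncomputable def sinMoment (κ δ : ℝ) (F : ℝ → ℂ) : ℂ :=
  windowMean δ fun v => (Real.sin (κ * v) : ℂ) * F v

section Moments

variable {κ δ : ℝ} {F : ℝ → ℂ}

lemma windowMean_planeWave_sub_mul (hF : Continuous F) (x : ℝ) :
    windowMean δ (fun v => planeWave κ (x - v) * F v)
      = planeWave κ x * (cosMoment κ δ F - Complex.I * sinMoment κ δ F) := by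
  rw [cosMoment, sinMoment, ← windowMean_const_mul, ← windowMean_sub (by fun_prop) (by fun_prop),
    ← windowMean_const_mul]
  congr 1
  ext v
  rw [sub_eq_add_neg, planeWave_add, planeWave_neg_eq]
  ring

lemma windowMean_planeWave_add_mul (hF : Continuous F) (x : ℝ) :
    windowMean δ (fun v => planeWave κ (x + v) * F v)
      = planeWave κ x * (cosMoment κ δ F + Complex.I * sinMoment κ δ F) := by
  rw [cosMoment, sinMoment, ← windowMean_const_mul, ← windowMean_add (by fun_prop) (by fun_prop),
    ← windowMean_const_mul]
  congr 1
  ext v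
  rw [planeWave_add, planeWave_eq κ v]
  ring

variable {u : ℝ} (hκ : 0 < κ) (hδ : 0 < δ) (hu : ∀ v, |v| ≤ δ / 2 → ‖F v‖ ≤ u)

include hδ hu

lemma nonneg_of_window_bound : 0 ≤ u :=
  (norm_nonneg _).trans (hu 0 (by rw [abs_zero]; positivity))

lemma norm_cosMoment_le : ‖cosMoment κ δ F‖ ≤ u := by
  have hu0 := nonneg_of_window_bound hδ hu
  refine norm_windowMean_le hδ fun v hv => ?_
  rw [norm_mul, Complex.norm_real, Real.norm_eq_abs]
  calc _ ≤ 1 * u := by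
        gcongr
        exacts [Real.abs_cos_le_one _, hu v hv]
    _ = u := one_mul u

lemma norm_sinMoment_le : ‖sinMoment κ δ F‖ ≤ u := by
  have hu0 := nonneg_of_window_bound hδ hu
  refine norm_windowMean_le hδ fun v hv => ?_
  rw [norm_mul, Complex.norm_real, Real.norm_eq_abs]
  calc _ ≤ 1 * u := by
        gcongr
        exacts [Real.abs_sin_le_one _, hu v hv]
    _ = u := one_mul u

include hκ

lemma norm_sinMoment_le_mul : ‖sinMoment κ δ F‖ ≤ κ * δ * u := by
  have hu0 := nonneg_of_window_bound hδ hu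
  refine norm_windowMean_le hδ fun v hv => ?_
  rw [norm_mul, Complex.norm_real, Real.norm_eq_abs]
  gcongr
  · refine (Real.abs_sin_le_abs).trans ?_
    rw [abs_mul, abs_of_pos hκ]
    gcongr
    linarith
  · exact hu v hv

omit hκ hδ hu in
lemma abs_cos_sub_cos_le (x y : ℝ) : |Real.cos x - Real.cos y| ≤ |x - y| := by
  have := Real.lipschitzWith_cos.dist_le_mul x y
  simpa [Real.dist_eq] using this

variable {a b β : ℂ} {B : ℝ} (hβ : ‖β‖ ≤ B) (hF : Continuous F)
  (hloc : ∀ v, |v| ≤ δ / 2 → F v = planeWave κ v * a + planeWave κ (-v) * b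
    + β * windowMean δ fun w => planeWave κ |v - w| * F w)

include hβ hloc

omit hκ in
lemma norm_incoming_sum_le : ‖a + b‖ ≤ (1 + B) * u := by
  have hu0 := nonneg_of_window_bound hδ hu
  have h0 : |(0 : ℝ)| ≤ δ / 2 := by rw [abs_zero]; positivity
  have h := hloc 0 h0
  simp only [neg_zero, planeWave_zero, one_mul] at h
  have h' : a + b = F 0 - β * windowMean δ fun w => planeWave κ |0 - w| * F w := by
    rw [h]; ring
  have hw : ‖windowMean δ fun w => planeWave κ |0 - w| * F w‖ ≤ u :=
    norm_windowMean_le hδ fun v hv => by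
      rw [norm_mul, norm_planeWave, one_mul]; exact hu v hv
  calc ‖a + b‖ ≤ ‖F 0‖ + ‖β‖ * ‖windowMean δ fun w => planeWave κ |0 - w| * F w‖ := by
        rw [h', ← norm_mul]; exact norm_sub_le _ _
    _ ≤ u + B * u := by
        have hB := (norm_nonneg β).trans hβ
        gcongr
        exact hu 0 h0
    _ = _ := by ring

include hF

lemma norm_sub_le_of_window {v v' : ℝ} (hv : |v| ≤ δ / 2) (hv' : |v'| ≤ δ / 2) :
    ‖F v - F v'‖ ≤ κ * δ * ((1 + 2 * B) * u + ‖a - b‖) := by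
  have hu0 := nonneg_of_window_bound hδ hu
  have hB := (norm_nonneg β).trans hβ
  have hvv : |v - v'| ≤ δ := (abs_sub _ _).trans (by linarith)
  have hk : |κ * v - κ * v'| ≤ κ * δ := by
    rw [← mul_sub, abs_mul, abs_of_pos hκ]; gcongr
  have hs := norm_incoming_sum_le hδ hu hβ hloc
  have key : F v - F v' =
      ((Real.cos (κ * v) - Real.cos (κ * v') : ℝ) : ℂ) * (a + b)
      + Complex.I * ((Real.sin (κ * v) - Real.sin (κ * v') : ℝ) : ℂ) * (a - b)
      + β * windowMean δ fun w => (planeWave κ |v - w| - planeWave κ |v' - w|) * F w := by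
    simp only [sub_mul]
    rw [windowMean_sub (by fun_prop) (by fun_prop), hloc v hv, hloc v' hv', planeWave_eq κ v,
      planeWave_neg_eq κ v, planeWave_eq κ v', planeWave_neg_eq κ v']
    push_cast
    ring
  have hw : ‖windowMean δ fun w => (planeWave κ |v - w| - planeWave κ |v' - w|) * F w‖
      ≤ κ * δ * u := by
    refine norm_windowMean_le hδ fun w hw => ?_
    rw [norm_mul]
    gcongr
    · refine (norm_planeWave_sub_le _ _ _).trans ?_
      rw [abs_mul, abs_of_pos hκ]
      gcongr
      refine (abs_abs_sub_abs_le_abs_sub _ _).trans ?_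
      rwa [sub_sub_sub_cancel_right]
    · exact hu w hw
  rw [key]
  refine (norm_add₃_le).trans ?_
  simp only [norm_mul, Complex.norm_I, one_mul, Complex.norm_real, Real.norm_eq_abs]
  calc _ ≤ κ * δ * ((1 + B) * u) + κ * δ * ‖a - b‖ + B * (κ * δ * u) := by
        gcongr
        · exact (abs_cos_sub_cos_le _ _).trans hk
        · exact (Real.abs_sin_sub_sin_le _ _).trans hk
    _ = _ := by ring

lemma norm_sinMoment_le_sq :
    ‖sinMoment κ δ F‖ ≤ (κ * δ) ^ 2 * ((1 + 2 * B) * u + ‖a - b‖) := by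
  have hu0 := nonneg_of_window_bound hδ hu
  have h0 : |(0 : ℝ)| ≤ δ / 2 := by rw [abs_zero]; positivity
  have hodd : windowMean δ (fun v => (Real.sin (κ * v) : ℂ) * F 0) = 0 :=
    windowMean_of_odd fun v => by rw [mul_neg, Real.sin_neg]; push_cast; ring
  have h : sinMoment κ δ F = windowMean δ fun v => (Real.sin (κ * v) : ℂ) * (F v - F 0) := by
    simp only [mul_sub]
    rw [windowMean_sub (by fun_prop) (by fun_prop), hodd, sub_zero, sinMoment]
  rw [h]
  refine norm_windowMean_le hδ fun v hv => ?_
  rw [norm_mul, Complex.norm_real, Real.norm_eq_abs, sq, mul_assoc (κ * δ)]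
  gcongr
  · refine (Real.abs_sin_le_abs).trans ?_
    rw [abs_mul, abs_of_pos hκ]
    gcongr
    linarith
  · exact norm_sub_le_of_window hκ hδ hu hβ hF hloc hv h0

lemma norm_le_cosMoment {v : ℝ} (hv : |v| ≤ δ / 2) :
    ‖F v‖ ≤ ‖cosMoment κ δ F‖ + κ * δ * ((2 + 2 * B) * u + ‖a - b‖) := by
  have hu0 := nonneg_of_window_bound hδ hu
  have h : F v = cosMoment κ δ F
      + windowMean δ fun w => F v - (Real.cos (κ * w) : ℂ) * F w := by
    rw [windowMean_sub (by fun_prop) (by fun_prop), windowMean_const hδ, cosMoment]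
    ring
  have hw : ‖windowMean δ fun w => F v - (Real.cos (κ * w) : ℂ) * F w‖
      ≤ κ * δ * ((2 + 2 * B) * u + ‖a - b‖) := by
    refine norm_windowMean_le hδ fun w hw => ?_
    have h1 : F v - (Real.cos (κ * w) : ℂ) * F w
        = (F v - F w) + ((Real.cos 0 - Real.cos (κ * w) : ℝ) : ℂ) * F w := by
      rw [Real.cos_zero]; push_cast; ring
    rw [h1]
    refine (norm_add_le _ _).trans ?_
    rw [norm_mul, Complex.norm_real, Real.norm_eq_abs]
    calc _ ≤ κ * δ * ((1 + 2 * B) * u + ‖a - b‖) + κ * δ * u := by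
          gcongr
          · exact norm_sub_le_of_window hκ hδ hu hβ hF hloc hv hw
          · refine (abs_cos_sub_cos_le _ _).trans ?_
            rw [zero_sub, abs_neg, abs_mul, abs_of_pos hκ]
            gcongr
            linarith
          · exact hu w hw
      _ = _ := by ring
  calc ‖F v‖ = _ := congrArg norm h
    _ ≤ _ := (norm_add_le _ _).trans (by gcongr)

lemma norm_cosMoment_sub_incoming_le :
    ‖(1 - β) * cosMoment κ δ F - (a + b)‖ ≤ κ * δ * ((1 + 3 * B) * u) := by
  have hu0 := nonneg_of_window_bound hδ hu
  have hB := (norm_nonneg β).trans hβ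
  have hs := norm_incoming_sum_le hδ hu hβ hloc
  have hodd : windowMean δ
      (fun v => (Real.cos (κ * v) : ℂ) * (Complex.I * (Real.sin (κ * v) : ℂ) * (a - b))) = 0 :=
    windowMean_of_odd fun v => by
      rw [mul_neg, Real.sin_neg, Real.cos_neg]; push_cast; ring
  have h : (1 - β) * cosMoment κ δ F - (a + b) = windowMean δ fun v =>
      (Real.cos (κ * v) : ℂ) * F v
        - ((Real.cos (κ * v) : ℂ) * (Complex.I * (Real.sin (κ * v) : ℂ) * (a - b))
          + ((a + b) + β * cosMoment κ δ F)) := by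
    rw [windowMean_sub (by fun_prop) (by fun_prop), windowMean_add (by fun_prop) (by fun_prop),
      hodd, windowMean_const hδ]
    rw [← cosMoment]
    ring
  have hk : ∀ v, |v| ≤ δ / 2 → |κ * v| ≤ κ * δ := fun v hv => by
    rw [abs_mul, abs_of_pos hκ]; gcongr; linarith
  rw [h]
  refine norm_windowMean_le hδ fun v hv => ?_
  have key : (Real.cos (κ * v) : ℂ) * F v
        - ((Real.cos (κ * v) : ℂ) * (Complex.I * (Real.sin (κ * v) : ℂ) * (a - b))
          + ((a + b) + β * cosMoment κ δ F))
      = -(((Real.sin (κ * v) * Real.sin (κ * v) : ℝ) : ℂ) * (a + b))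
        + β * windowMean δ fun w =>
          ((Real.cos (κ * v) : ℂ) * planeWave κ |v - w| - (Real.cos (κ * w) : ℂ)) * F w := by
    have hsc : (Real.sin (κ * v) : ℂ) * (Real.sin (κ * v) : ℂ)
        = 1 - (Real.cos (κ * v) : ℂ) * (Real.cos (κ * v) : ℂ) := by
      have := Real.sin_sq_add_cos_sq (κ * v)
      have h2 : (Real.sin (κ * v)) * (Real.sin (κ * v))
        = 1 - (Real.cos (κ * v)) * (Real.cos (κ * v)) := by linarith
      exact_mod_cast h2
    simp only [sub_mul, mul_assoc]
    rw [windowMean_sub (by fun_prop) (by fun_prop), windowMean_const_mul, ← cosMoment]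
    nth_rewrite 1 [hloc v hv]
    rw [planeWave_eq κ v, planeWave_neg_eq κ v]
    push_cast at hsc ⊢
    linear_combination (a + b) * hsc
  have hw : ‖windowMean δ fun w =>
      ((Real.cos (κ * v) : ℂ) * planeWave κ |v - w| - (Real.cos (κ * w) : ℂ)) * F w‖
      ≤ 2 * (κ * δ) * u := by
    refine norm_windowMean_le hδ fun w hw => ?_
    have hvw : |v - w| ≤ δ := (abs_sub _ _).trans (by linarith)
    have hkvw : κ * |v - w| ≤ κ * δ := by gcongr
    rw [norm_mul]
    gcongr
    · have h1 : (Real.cos (κ * v) : ℂ) * planeWave κ |v - w| - (Real.cos (κ * w) : ℂ)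
          = (Real.cos (κ * v) : ℂ) * (planeWave κ |v - w| - 1)
            + ((Real.cos (κ * v) - Real.cos (κ * w) : ℝ) : ℂ) := by push_cast; ring
      rw [h1]
      refine (norm_add_le _ _).trans ?_
      rw [norm_mul, Complex.norm_real, Complex.norm_real, Real.norm_eq_abs, Real.norm_eq_abs]
      have h2 := norm_planeWave_sub_one_le κ |v - w|
      rw [abs_mul, abs_of_pos hκ, abs_abs] at h2
      have h3 := abs_cos_sub_cos_le (κ * v) (κ * w)
      rw [← mul_sub, abs_mul, abs_of_pos hκ] at h3
      have h4 := mul_le_mul (Real.abs_cos_le_one (κ * v)) h2 (norm_nonneg _) zero_le_one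
      linarith
    · exact hu w hw
  rw [key]
  refine (norm_add_le _ _).trans ?_
  rw [norm_neg, norm_mul, norm_mul, Complex.norm_real, Real.norm_eq_abs, abs_mul]
  calc _ ≤ (1 * (κ * δ)) * ((1 + B) * u) + B * (2 * (κ * δ) * u) := by
        gcongr
        · exact Real.abs_sin_le_one _
        · exact (Real.abs_sin_le_abs).trans (hk v hv)
    _ = _ := by ring

end Moments

section Amplitudes

variable (κ : ℝ) (β : ℂ) (τ : ℕ → ℝ) (p q : ℕ → ℂ)

/-- The amplitude at `τ m` of the right-going wave arriving at the `m`-th interval. -/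
noncomputable def rightAmp (m : ℕ) : ℂ :=
  planeWave κ (τ m)
    + β * ∑ j ∈ Finset.range m, planeWave κ (τ m - τ j) * (p j - Complex.I * q j)

/-- The amplitude at `τ m` of the left-going wave arriving at the `m`-th of `N` intervals. -/
noncomputable def leftAmp (N m : ℕ) : ℂ :=
  β * ∑ j ∈ Finset.Ico (m + 1) N, planeWave κ (τ j - τ m) * (p j + Complex.I * q j)

variable {κ β τ p q}

lemma sum_range_eq_add_Ico {M : Type*} [AddCommMonoid M] {m N : ℕ} (hm : m < N) (f : ℕ → M) :
    ∑ j ∈ Finset.range N, f j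
      = ∑ j ∈ Finset.range m, f j + f m + ∑ j ∈ Finset.Ico (m + 1) N, f j := by
  rw [← Finset.sum_range_succ, Finset.sum_range_add_sum_Ico f hm]

lemma field_on_window {δ : ℝ} {N : ℕ} {E : ℝ → ℂ} (hE : Continuous E) (hδ : 0 < δ)
    (hτ : ∀ i j, i < j → j < N → τ i + δ ≤ τ j)
    (hLS : ∀ t, E t = planeWave κ t + β * ∑ k ∈ Finset.range N,
      windowMean δ fun v => planeWave κ |t - (τ k + v)| * E (τ k + v))
    (hp : ∀ k, p k = cosMoment κ δ fun v => E (τ k + v))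
    (hq : ∀ k, q k = sinMoment κ δ fun v => E (τ k + v))
    {m : ℕ} (hm : m < N) {v : ℝ} (hv : |v| ≤ δ / 2) :
    E (τ m + v) = planeWave κ v * rightAmp κ β τ p q m
      + planeWave κ (-v) * leftAmp κ β τ p q N m
      + β * windowMean δ fun w => planeWave κ |v - w| * E (τ m + w) := by
  have hv' := abs_le.1 hv
  have hleft : ∀ j ∈ Finset.range m,
      windowMean δ (fun w => planeWave κ |τ m + v - (τ j + w)| * E (τ j + w))
        = planeWave κ v * (planeWave κ (τ m - τ j) * (p j - Complex.I * q j)) := by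
    intro j hj
    have hsep := hτ j m (Finset.mem_range.1 hj) hm
    rw [hp, hq, ← mul_assoc, ← planeWave_add, ← windowMean_planeWave_sub_mul (by fun_prop)]
    refine windowMean_congr hδ fun w hw => ?_
    have hw' := abs_le.1 hw
    rw [abs_of_nonneg (by linarith [hw'.2, hv'.1])]
    congr 2
    ring
  have hright : ∀ j ∈ Finset.Ico (m + 1) N,
      windowMean δ (fun w => planeWave κ |τ m + v - (τ j + w)| * E (τ j + w))
        = planeWave κ (-v) * (planeWave κ (τ j - τ m) * (p j + Complex.I * q j)) := by
    intro j hj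
    have hsep := hτ m j (Finset.mem_Ico.1 hj).1 (Finset.mem_Ico.1 hj).2
    rw [hp, hq, ← mul_assoc, ← planeWave_add, ← windowMean_planeWave_add_mul (by fun_prop)]
    refine windowMean_congr hδ fun w hw => ?_
    have hw' := abs_le.1 hw
    rw [abs_of_nonpos (by linarith [hw'.1, hv'.2])]
    congr 2
    ring
  rw [hLS, sum_range_eq_add_Ico hm, Finset.sum_congr rfl hleft, Finset.sum_congr rfl hright,
    ← Finset.mul_sum, ← Finset.mul_sum, rightAmp, leftAmp, add_comm (τ m) v, planeWave_add]
  simp only [add_comm v (τ m), add_sub_add_left_eq_sub]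
  ring

lemma incoming_sum_eq {N m m' : ℕ} (hm : m ≤ m') (hm' : m' < N) :
    rightAmp κ β τ p q m' + leftAmp κ β τ p q N m'
      = (Real.cos (κ * (τ m' - τ m)) : ℂ) * (rightAmp κ β τ p q m + leftAmp κ β τ p q N m)
        + Complex.I * (Real.sin (κ * (τ m' - τ m)) : ℂ)
          * (rightAmp κ β τ p q m - leftAmp κ β τ p q N m)
        + β * ∑ j ∈ Finset.Ico m m', 2 * Complex.I *
          ((Real.sin (κ * (τ m' - τ j)) : ℂ) * p j - (Real.cos (κ * (τ m' - τ j)) : ℂ) * q j)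
        - β * (p m' + Complex.I * q m')
        + β * (planeWave κ (τ m - τ m') * (p m + Complex.I * q m)) := by
  set G : ℕ → ℂ := fun j => planeWave κ (τ j - τ m') * (p j + Complex.I * q j) with hG
  have hr : rightAmp κ β τ p q m' = planeWave κ (τ m' - τ m) * rightAmp κ β τ p q m
      + β * ∑ j ∈ Finset.Ico m m', planeWave κ (τ m' - τ j) * (p j - Complex.I * q j) := by
    have h1 : planeWave κ (τ m') = planeWave κ (τ m' - τ m) * planeWave κ (τ m) := by
      rw [← planeWave_add, sub_add_cancel]
    have h2 : ∀ j, planeWave κ (τ m' - τ j)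
        = planeWave κ (τ m' - τ m) * planeWave κ (τ m - τ j) := fun j => by
      rw [← planeWave_add, sub_add_sub_cancel]
    rw [rightAmp, rightAmp, ← Finset.sum_range_add_sum_Ico _ hm, h1]
    have h3 : ∑ j ∈ Finset.range m, planeWave κ (τ m' - τ j) * (p j - Complex.I * q j)
        = planeWave κ (τ m' - τ m)
          * ∑ j ∈ Finset.range m, planeWave κ (τ m - τ j) * (p j - Complex.I * q j) := by
      rw [Finset.mul_sum]
      exact Finset.sum_congr rfl fun j _ => by rw [h2 j, mul_assoc]
    rw [h3]
    ring
  have hl : planeWave κ (-(τ m' - τ m)) * leftAmp κ β τ p q N m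
      = leftAmp κ β τ p q N m' + β * (∑ j ∈ Finset.Ico m m', G j + G m' - G m) := by
    have h2 : ∀ j, planeWave κ (-(τ m' - τ m)) * planeWave κ (τ j - τ m)
        = planeWave κ (τ j - τ m') := fun j => by
      rw [← planeWave_add]; congr 1; ring
    have h3 : planeWave κ (-(τ m' - τ m)) * leftAmp κ β τ p q N m
        = β * ∑ j ∈ Finset.Ico (m + 1) N, G j := by
      rw [leftAmp, mul_left_comm, Finset.mul_sum]
      congr 1
      exact Finset.sum_congr rfl fun j _ => by rw [← mul_assoc, h2 j]
    have h4 : leftAmp κ β τ p q N m' = β * ∑ j ∈ Finset.Ico (m' + 1) N, G j := rfl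
    have h5 := sum_range_eq_add_Ico (hm.trans_lt hm') G
    have h6 := sum_range_eq_add_Ico hm' G
    have h7 := Finset.sum_range_add_sum_Ico G hm
    rw [h3, h4]
    linear_combination β * (h6 - h5 - h7)
  have hsum : ∑ j ∈ Finset.Ico m m', 2 * Complex.I *
        ((Real.sin (κ * (τ m' - τ j)) : ℂ) * p j - (Real.cos (κ * (τ m' - τ j)) : ℂ) * q j)
      = ∑ j ∈ Finset.Ico m m', planeWave κ (τ m' - τ j) * (p j - Complex.I * q j)
        - ∑ j ∈ Finset.Ico m m', G j := by
    rw [← Finset.sum_sub_distrib]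
    refine Finset.sum_congr rfl fun j _ => ?_
    rw [hG]
    simp only
    rw [← neg_sub (τ m') (τ j), planeWave_eq, planeWave_neg_eq]
    ring
  have hGm' : G m' = p m' + Complex.I * q m' := by simp [hG]
  rw [planeWave_neg_eq] at hl
  rw [planeWave_eq κ (τ m' - τ m)] at hr
  rw [hsum, ← hGm']
  linear_combination hr - hl

variable {u : ℕ → ℝ} {B δ : ℝ} (hκ : 0 < κ) (hδ : 0 < δ) (hβ : ‖β‖ ≤ B)
  (hpu : ∀ k, ‖p k‖ ≤ u k) (hqu : ∀ k, ‖q k‖ ≤ u k)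

include hβ hpu hqu

lemma norm_incoming_diff_le_crude {N m : ℕ} (hm : m < N) :
    ‖rightAmp κ β τ p q m - leftAmp κ β τ p q N m‖
      ≤ 1 + 2 * B * ∑ j ∈ Finset.range N, u j := by
  have hB := (norm_nonneg β).trans hβ
  have hu0 : ∀ k, 0 ≤ u k := fun k => (norm_nonneg _).trans (hpu k)
  have h1 : ‖∑ j ∈ Finset.range m, planeWave κ (τ m - τ j) * (p j - Complex.I * q j)‖
      ≤ ∑ j ∈ Finset.range m, 2 * u j := norm_sum_le_of_le _ fun j _ => by
    rw [norm_mul, norm_planeWave, one_mul]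
    refine (norm_sub_le _ _).trans ?_
    rw [norm_mul, Complex.norm_I]
    linarith [hpu j, hqu j]
  have h2 : ‖∑ j ∈ Finset.Ico (m + 1) N, planeWave κ (τ j - τ m) * (p j + Complex.I * q j)‖
      ≤ ∑ j ∈ Finset.Ico (m + 1) N, 2 * u j := norm_sum_le_of_le _ fun j _ => by
    rw [norm_mul, norm_planeWave, one_mul]
    refine (norm_add_le _ _).trans ?_
    rw [norm_mul, Complex.norm_I]
    linarith [hpu j, hqu j]
  have h3 : ∑ j ∈ Finset.range m, 2 * u j + ∑ j ∈ Finset.Ico (m + 1) N, 2 * u j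
      ≤ 2 * ∑ j ∈ Finset.range N, u j := by
    rw [sum_range_eq_add_Ico hm, ← Finset.mul_sum, ← Finset.mul_sum]
    linarith [hu0 m]
  rw [rightAmp, leftAmp]
  refine (norm_sub_le _ _).trans ((add_le_add_left (norm_add_le _ _) _).trans ?_)
  rw [norm_planeWave, norm_mul, norm_mul]
  have h4 := mul_le_mul hβ h1 (norm_nonneg _) hB
  have h5 := mul_le_mul hβ h2 (norm_nonneg _) hB
  have h6 := mul_le_mul_of_nonneg_left h3 hB
  linarith

include hκ hδ

lemma norm_incoming_diff_le {N m M : ℕ} (hM : 0 < M) (hm : m + M < N)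
    (hτ : ∀ i j, i < j → j < N → ((j - i : ℕ) : ℝ) * δ ≤ τ j - τ i)
    (hqκ : ∀ k, ‖q k‖ ≤ κ * δ * u k)
    (hs : ∀ k < N, ‖rightAmp κ β τ p q k + leftAmp κ β τ p q N k‖ ≤ (1 + B) * u k)
    (hx : κ * (τ (m + M) - τ m) ≤ 1) :
    ‖rightAmp κ β τ p q m - leftAmp κ β τ p q N m‖
      ≤ 2 * (1 + 3 * B) / (κ * (M * δ)) * (u m + u (m + M))
        + 8 * B * ∑ j ∈ Finset.range M, u (m + j) := by
  have hB := (norm_nonneg β).trans hβ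
  have hu0 : ∀ k, 0 ≤ u k := fun k => (norm_nonneg _).trans (hpu k)
  have hM' : (0 : ℝ) < M := by exact_mod_cast hM
  have hMone : (1 : ℝ) ≤ M := by exact_mod_cast hM
  set Δ := τ (m + M) - τ m with hΔ
  have hΔM : M * δ ≤ Δ := by simpa using hτ m (m + M) (by omega) hm
  have hΔδ : δ ≤ Δ := by nlinarith
  have hΔ0 : 0 < Δ := hδ.trans_le hΔδ
  set d := rightAmp κ β τ p q m - leftAmp κ β τ p q N m with hd
  have key := incoming_sum_eq (κ := κ) (β := β) (τ := τ) (p := p) (q := q)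
    (Nat.le_add_right m M) hm
  rw [← hΔ, ← hd] at key
  have hsum : ‖∑ j ∈ Finset.Ico m (m + M), 2 * Complex.I *
      ((Real.sin (κ * (τ (m + M) - τ j)) : ℂ) * p j
        - (Real.cos (κ * (τ (m + M) - τ j)) : ℂ) * q j)‖
      ≤ 4 * (κ * Δ) * ∑ j ∈ Finset.range M, u (m + j) := by
    rw [Finset.sum_Ico_eq_sum_range, Nat.add_sub_cancel_left, Finset.mul_sum]
    refine norm_sum_le_of_le _ fun j hj => ?_
    have hjM := Finset.mem_range.1 hj
    have h1 := hτ (m + j) (m + M) (by omega) hm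
    have h2 : τ (m + M) - τ (m + j) ≤ Δ := by
      rcases Nat.eq_zero_or_pos j with rfl | hj0
      · simp [hΔ]
      · have := hτ m (m + j) (by omega) (by omega)
        have h3 : 0 ≤ ((m + j - m : ℕ) : ℝ) * δ := by positivity
        linarith
    have h3 : 0 ≤ τ (m + M) - τ (m + j) := le_trans (by positivity) h1
    have hsin : |Real.sin (κ * (τ (m + M) - τ (m + j)))| ≤ κ * Δ := by
      refine Real.abs_sin_le_abs.trans ?_
      rw [abs_of_nonneg (by positivity)]
      gcongr
    rw [norm_mul, norm_mul, Complex.norm_I, Complex.norm_ofNat, mul_one]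
    have h4 := mul_le_mul hsin (hpu (m + j)) (norm_nonneg _) (by positivity)
    have h5 := mul_le_mul (Real.abs_cos_le_one (κ * (τ (m + M) - τ (m + j)))) (hqκ (m + j))
      (norm_nonneg _) zero_le_one
    have h6 : κ * δ * u (m + j) ≤ κ * Δ * u (m + j) := by
      have := hu0 (m + j)
      gcongr
    have h7 := norm_sub_le ((Real.sin (κ * (τ (m + M) - τ (m + j))) : ℂ) * p (m + j))
      ((Real.cos (κ * (τ (m + M) - τ (m + j))) : ℂ) * q (m + j))
    rw [norm_mul, norm_mul, Complex.norm_real, Complex.norm_real, Real.norm_eq_abs,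
      Real.norm_eq_abs] at h7
    linarith
  have hG : ∀ k x, ‖planeWave κ x * (p k + Complex.I * q k)‖ ≤ 2 * u k := fun k x => by
    rw [norm_mul, norm_planeWave, one_mul]
    refine (norm_add_le _ _).trans ?_
    rw [norm_mul, Complex.norm_I]
    linarith [hpu k, hqu k]
  have hG0 := hG (m + M) 0
  rw [planeWave_zero, one_mul] at hG0
  have hd_le : |Real.sin (κ * Δ)| * ‖d‖ ≤ (1 + 3 * B) * (u m + u (m + M))
      + B * (4 * (κ * Δ) * ∑ j ∈ Finset.range M, u (m + j)) := by
    have hrw : Complex.I * (Real.sin (κ * Δ) : ℂ) * d =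
        (rightAmp κ β τ p q (m + M) + leftAmp κ β τ p q N (m + M))
        - (Real.cos (κ * Δ) : ℂ) * (rightAmp κ β τ p q m + leftAmp κ β τ p q N m)
        - β * ∑ j ∈ Finset.Ico m (m + M), 2 * Complex.I *
          ((Real.sin (κ * (τ (m + M) - τ j)) : ℂ) * p j
            - (Real.cos (κ * (τ (m + M) - τ j)) : ℂ) * q j)
        + β * (p (m + M) + Complex.I * q (m + M))
        - β * (planeWave κ (τ m - τ (m + M)) * (p m + Complex.I * q m)) := by
      linear_combination -key
    have hn : |Real.sin (κ * Δ)| * ‖d‖ = ‖Complex.I * (Real.sin (κ * Δ) : ℂ) * d‖ := by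
      rw [norm_mul, norm_mul, Complex.norm_I, one_mul, Complex.norm_real, Real.norm_eq_abs]
    rw [hn, hrw]
    refine (norm_sub_le _ _).trans ((add_le_add_left (norm_add_le _ _) _).trans
      ((add_le_add_left (add_le_add_left (norm_sub_le _ _) _) _).trans
      ((add_le_add_left (add_le_add_left (add_le_add_left (norm_sub_le _ _) _) _) _).trans ?_)))
    simp only [norm_mul β, norm_mul (Real.cos (κ * Δ) : ℂ), Complex.norm_real, Real.norm_eq_abs]
    have h1 := hs (m + M) hm
    have h2 := mul_le_mul (Real.abs_cos_le_one (κ * Δ)) (hs m (by omega)) (norm_nonneg _)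
      zero_le_one
    have h3 := mul_le_mul hβ hsum (norm_nonneg _) hB
    have h4 := mul_le_mul hβ hG0 (norm_nonneg _) hB
    have h5 := mul_le_mul hβ (hG m (τ m - τ (m + M))) (norm_nonneg _) hB
    linarith
  have hsin : κ * Δ / 2 ≤ |Real.sin (κ * Δ)| := by
    have hpos : 0 ≤ κ * Δ := by positivity
    have h1 := Real.mul_le_sin hpos (by linarith [Real.pi_gt_three])
    have h2 : (1 : ℝ) / 2 ≤ 2 / Real.pi := by
      rw [div_le_div_iff₀ two_pos Real.pi_pos]
      linarith [Real.pi_le_four]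
    refine le_trans ?_ (h1.trans (le_abs_self _))
    nlinarith
  have h1 : κ * Δ / 2 * ‖d‖ ≤ (1 + 3 * B) * (u m + u (m + M))
      + B * (4 * (κ * Δ) * ∑ j ∈ Finset.range M, u (m + j)) :=
    (mul_le_mul_of_nonneg_right hsin (norm_nonneg _)).trans hd_le
  have hκΔ : 0 < κ * Δ := by positivity
  have h2 : ‖d‖ ≤ 2 * (1 + 3 * B) / (κ * Δ) * (u m + u (m + M))
      + 8 * B * ∑ j ∈ Finset.range M, u (m + j) := by
    have h3 : κ * Δ / 2 * (2 * (1 + 3 * B) / (κ * Δ) * (u m + u (m + M))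
      + 8 * B * ∑ j ∈ Finset.range M, u (m + j)) = (1 + 3 * B) * (u m + u (m + M))
      + B * (4 * (κ * Δ) * ∑ j ∈ Finset.range M, u (m + j)) := by
      field_simp
      ring
    rw [← h3] at h1
    exact le_of_mul_le_mul_left h1 (by positivity)
  refine h2.trans ?_
  have := hu0 m
  have := hu0 (m + M)
  gcongr

end Amplitudes

lemma sum_range_shift_le {f : ℕ → ℝ} (hf : ∀ k, 0 ≤ f k) {j K N : ℕ} (h : j + K ≤ N) :
    ∑ m ∈ Finset.range K, f (m + j) ≤ ∑ m ∈ Finset.range N, f m := by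
  calc ∑ m ∈ Finset.range K, f (m + j) = ∑ m ∈ Finset.range K, f (j + m) := by
        simp only [add_comm]
    _ ≤ ∑ m ∈ Finset.range (j + K), f m := by
        rw [Finset.sum_range_add]
        exact le_add_of_nonneg_left (Finset.sum_nonneg fun _ _ => hf _)
    _ ≤ _ := Finset.sum_le_sum_of_subset_of_nonneg (Finset.range_subset_range.2 h)
        fun _ _ _ => hf _

lemma sum_range_shift_sub_le {τ : ℕ → ℝ} {T : ℝ} (h0 : ∀ k, 0 ≤ τ k) (hT : ∀ k, τ k ≤ T)
    (K M : ℕ) : ∑ m ∈ Finset.range K, (τ (m + M) - τ m) ≤ M * T := by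
  have h1 := Finset.sum_range_add τ M K
  have h2 := Finset.sum_range_add τ K M
  rw [add_comm M K] at h1
  have h3 : ∑ m ∈ Finset.range K, τ (m + M) = ∑ m ∈ Finset.range K, τ (M + m) := by
    simp only [add_comm]
  have h4 : ∑ x ∈ Finset.range M, τ (K + x) ≤ M * T := by
    refine (Finset.sum_le_sum fun x _ => hT (K + x)).trans ?_
    simp
  have h5 : 0 ≤ ∑ x ∈ Finset.range M, τ x := Finset.sum_nonneg fun _ _ => h0 _
  rw [Finset.sum_sub_distrib, h3]
  linarith

lemma sq_sum_range_le (f : ℕ → ℝ) (n : ℕ) :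
    (∑ j ∈ Finset.range n, f j) ^ 2 ≤ n * ∑ j ∈ Finset.range n, f j ^ 2 := by
  simpa using sq_sum_le_card_mul_sum_sq (s := Finset.range n) (f := f)

/-- If `d m` is controlled by `u` near `m` and `m + M` whenever `τ m` and `τ (m + M)` are close,
then `d` is controlled in `ℓ²`, since `τ m` and `τ (m + M)` are far apart only for few `m`. -/
lemma sum_sq_le_of_shift_bound {u d τ : ℕ → ℝ} {κ T X Y R : ℝ} {N M : ℕ} (hκ : 0 ≤ κ)
    (hR : 0 ≤ R) (hT0 : 0 ≤ T) (hd : ∀ k, 0 ≤ d k)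
    (h0 : ∀ k, 0 ≤ τ k) (hT : ∀ k, τ k ≤ T) (hmono : ∀ m, m + M < N → τ m ≤ τ (m + M))
    (hnear : ∀ m, m + M < N → κ * (τ (m + M) - τ m) ≤ 1 →
      d m ≤ X * (u m + u (m + M)) + Y * ∑ j ∈ Finset.range M, u (m + j))
    (hfar : ∀ m < N, d m ^ 2 ≤ R) :
    ∑ m ∈ Finset.range N, d m ^ 2
      ≤ (8 * X ^ 2 + 2 * Y ^ 2 * M ^ 2) * ∑ m ∈ Finset.range N, u m ^ 2
        + (κ * T + 1) * M * R := by
  have hU : 0 ≤ ∑ m ∈ Finset.range N, u m ^ 2 := Finset.sum_nonneg fun _ _ => sq_nonneg _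
  rcases le_or_gt N M with hNM | hNM
  · have h1 : ∑ m ∈ Finset.range N, d m ^ 2 ≤ M * R := by
      refine (Finset.sum_le_sum fun m hm => hfar m (Finset.mem_range.1 hm)).trans ?_
      have : (N : ℝ) ≤ M := by exact_mod_cast hNM
      simp only [Finset.sum_const, Finset.card_range, nsmul_eq_mul]
      gcongr
    have h2 : 0 ≤ κ * T * M * R := by positivity
    have h3 : 0 ≤ (8 * X ^ 2 + 2 * Y ^ 2 * M ^ 2) * ∑ m ∈ Finset.range N, u m ^ 2 := by positivity
    linarith
  obtain ⟨K, rfl⟩ := Nat.exists_eq_add_of_le' hNM.le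
  set U := ∑ m ∈ Finset.range (K + M), u m ^ 2 with hUdef
  have hterm : ∀ m ∈ Finset.range K, d m ^ 2 ≤ 4 * X ^ 2 * u m ^ 2 + 4 * X ^ 2 * u (m + M) ^ 2
      + 2 * Y ^ 2 * M * ∑ j ∈ Finset.range M, u (m + j) ^ 2 + κ * R * (τ (m + M) - τ m) := by
    intro m hm
    have hmK := Finset.mem_range.1 hm
    have hΔ : 0 ≤ τ (m + M) - τ m := sub_nonneg.2 (hmono m (by omega))
    have hS : 0 ≤ ∑ j ∈ Finset.range M, u (m + j) ^ 2 := Finset.sum_nonneg fun _ _ => sq_nonneg _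
    rcases le_or_gt (κ * (τ (m + M) - τ m)) 1 with h | h
    · have h1 := hnear m (by omega) h
      have h2 := sq_sum_range_le (fun j => u (m + j)) M
      have h3 : d m ^ 2 ≤
          (X * (u m + u (m + M)) + Y * ∑ j ∈ Finset.range M, u (m + j)) ^ 2 :=
        pow_le_pow_left₀ (hd m) h1 2
      have h4 : 0 ≤ κ * R * (τ (m + M) - τ m) := by positivity
      have h5 := add_sq_le (a := X * (u m + u (m + M)))
        (b := Y * ∑ j ∈ Finset.range M, u (m + j))
      have h6 := mul_le_mul_of_nonneg_left h2 (sq_nonneg Y)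
      have h7 := mul_le_mul_of_nonneg_left (add_sq_le (a := u m) (b := u (m + M))) (sq_nonneg X)
      rw [mul_pow, mul_pow] at h5
      linarith
    · have h1 := hfar m (by omega)
      have h2 : R ≤ κ * R * (τ (m + M) - τ m) := by nlinarith
      have h3 : 0 ≤ 4 * X ^ 2 * u m ^ 2 + 4 * X ^ 2 * u (m + M) ^ 2
        + 2 * Y ^ 2 * M * ∑ j ∈ Finset.range M, u (m + j) ^ 2 := by positivity
      linarith
  have h1 := Finset.sum_le_sum hterm
  simp only [Finset.sum_add_distrib, ← Finset.mul_sum] at h1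
  have hA : ∑ m ∈ Finset.range K, u m ^ 2 ≤ U :=
    sum_range_shift_le (f := fun k => u k ^ 2) (fun _ => sq_nonneg _) (j := 0) (by omega)
  have hA' : ∑ m ∈ Finset.range K, u (m + M) ^ 2 ≤ U :=
    sum_range_shift_le (f := fun k => u k ^ 2) (fun _ => sq_nonneg _) (by omega)
  have hB : ∑ m ∈ Finset.range K, ∑ j ∈ Finset.range M, u (m + j) ^ 2 ≤ M * U := by
    rw [Finset.sum_comm]
    refine (Finset.sum_le_sum fun j hj => sum_range_shift_le (f := fun k => u k ^ 2)
      (fun _ => sq_nonneg _) (N := K + M) ?_).trans ?_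
    · have := Finset.mem_range.1 hj
      omega
    · simp [hUdef]
  have hC := sum_range_shift_sub_le h0 hT K M
  have hD : ∑ x ∈ Finset.range M, d (K + x) ^ 2 ≤ M * R := by
    refine (Finset.sum_le_sum fun x hx => hfar (K + x) ?_).trans ?_
    · have := Finset.mem_range.1 hx
      omega
    · simp
  rw [Finset.sum_range_add]
  have h2 := mul_le_mul_of_nonneg_left hA (show 0 ≤ 4 * X ^ 2 by positivity)
  have h3 := mul_le_mul_of_nonneg_left hA' (show 0 ≤ 4 * X ^ 2 by positivity)
  have h4 := mul_le_mul_of_nonneg_left hB (show 0 ≤ 2 * Y ^ 2 * M by positivity)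
  have h5 := mul_le_mul_of_nonneg_left hC (show 0 ≤ κ * R by positivity)
  linarith

/-- The `ℓ²` bound for the amplitude differences with the shift `M` of order `η⁻¹`, `η² = δ`. -/
lemma shift_bound_rescaled {κ T B c₂ η M N U D : ℝ} (hκ : 0 < κ) (hT : 0 ≤ T) (hB : 0 ≤ B)
    (hη : 0 < η) (hη1 : η ≤ 1) (hM1 : 1 / η ≤ M) (hM2 : M ≤ 2 / η) (hU : 0 ≤ U)
    (hN : N * η ^ 2 ≤ c₂)
    (hD : D ≤ (8 * (2 * (1 + 3 * B) / (κ * (M * η ^ 2))) ^ 2 + 2 * (8 * B) ^ 2 * M ^ 2) * U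
      + (κ * T + 1) * M * (2 + 8 * B ^ 2 * (N * U))) (hN0 : 0 ≤ N) :
    η ^ 4 * D ≤ (32 * (1 + 3 * B) ^ 2 / κ ^ 2 + 512 * B ^ 2
      + (κ * T + 1) * (4 + 16 * B ^ 2 * c₂)) * η * (1 + U) := by
  have hMpos : 0 < M := lt_of_lt_of_le (by positivity) hM1
  have hηM1 : 1 ≤ η * M := by rwa [div_le_iff₀' hη] at hM1
  have hηM2 : η * M ≤ 2 := by rwa [le_div_iff₀' hη] at hM2
  have h1 : η ^ 4 * (2 * (1 + 3 * B) / (κ * (M * η ^ 2))) ^ 2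
      ≤ 4 * (1 + 3 * B) ^ 2 / κ ^ 2 * η := by
    have e : η ^ 4 * (2 * (1 + 3 * B) / (κ * (M * η ^ 2))) ^ 2
        = 4 * (1 + 3 * B) ^ 2 / κ ^ 2 * (1 / M) ^ 2 := by
      field_simp
      ring
    rw [e]
    have h2 : 1 / M ≤ η := by rw [div_le_iff₀ hMpos]; exact hηM1
    have h3 : (1 / M) ^ 2 ≤ η := by
      calc (1 / M) ^ 2 ≤ η ^ 2 := by gcongr
        _ ≤ η := by nlinarith
    gcongr
  have h2 : η ^ 4 * (2 * (8 * B) ^ 2 * M ^ 2) ≤ 512 * B ^ 2 * η := by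
    have e : η ^ 4 * (2 * (8 * B) ^ 2 * M ^ 2) = 128 * B ^ 2 * ((η * M) ^ 2 * (η * η)) := by ring
    have h3 : (η * M) ^ 2 * (η * η) ≤ 2 ^ 2 * (1 * η) := by gcongr
    rw [e]
    nlinarith [mul_le_mul_of_nonneg_left h3 (show 0 ≤ 128 * B ^ 2 by positivity)]
  have h3 : η ^ 4 * (M * (2 + 8 * B ^ 2 * (N * U))) ≤ (4 + 16 * B ^ 2 * c₂ * U) * η := by
    have e : η ^ 4 * (M * (2 + 8 * B ^ 2 * (N * U)))
        = (η * M) * (2 * (η ^ 2 * η) + 8 * B ^ 2 * (N * η ^ 2 * U) * η) := by ring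
    rw [e]
    have h4 : η ^ 2 * η ≤ 1 * η := by
      gcongr
      exact pow_le_one₀ hη.le hη1
    calc _ ≤ 2 * (2 * (1 * η) + 8 * B ^ 2 * (c₂ * U) * η) := by gcongr
      _ = _ := by ring
  have h4 := mul_le_mul_of_nonneg_left h3 (show 0 ≤ κ * T + 1 by positivity)
  have h5 := mul_le_mul_of_nonneg_right h1 hU
  have h6 := mul_le_mul_of_nonneg_right h2 hU
  have h7 := mul_le_mul_of_nonneg_left hD (show 0 ≤ η ^ 4 by positivity)
  have hc₂ : 0 ≤ c₂ := le_trans (by positivity) hN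
  have h8 : 0 ≤ (32 * (1 + 3 * B) ^ 2 / κ ^ 2 + 512 * B ^ 2) * η := by positivity
  have h9 : 0 ≤ (κ * T + 1) * (4 * U + 16 * B ^ 2 * c₂) * η := by positivity
  have h10 : 32 * (1 + 3 * B) ^ 2 / κ ^ 2 = 8 * (4 * (1 + 3 * B) ^ 2 / κ ^ 2) := by ring
  rw [h10] at h8 ⊢
  linarith

lemma sum_sq_residual_le {x z u d : ℕ → ℝ} {N : ℕ} {B K₁ K₂ K₃ c₂ δ : ℝ}
    (hx0 : ∀ k < N, 0 ≤ x k) (hz0 : ∀ k < N, 0 ≤ z k)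
    (hx : ∀ k < N, x k ≤ 1 + δ * K₁ * u k + B * ∑ j ∈ Finset.range N, z j)
    (hz : ∀ k < N, z k ≤ δ ^ 2 * (K₂ * u k + K₃ * d k)) (hδ : 0 ≤ δ) (hN : N * δ ≤ c₂) :
    ∑ k ∈ Finset.range N, x k ^ 2 ≤ 3 * N
      + 3 * K₁ ^ 2 * (δ ^ 2 * ∑ k ∈ Finset.range N, u k ^ 2)
      + 6 * (B ^ 2 * c₂ ^ 2) * (K₂ ^ 2 * (δ ^ 2 * ∑ k ∈ Finset.range N, u k ^ 2)
        + K₃ ^ 2 * (δ ^ 2 * ∑ k ∈ Finset.range N, d k ^ 2)) := by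
  set Z := ∑ j ∈ Finset.range N, z j with hZ
  set U := ∑ k ∈ Finset.range N, u k ^ 2
  set D := ∑ k ∈ Finset.range N, d k ^ 2
  have hU0 : 0 ≤ U := Finset.sum_nonneg fun _ _ => sq_nonneg _
  have hD0 : 0 ≤ D := Finset.sum_nonneg fun _ _ => sq_nonneg _
  have h1 : ∀ k ∈ Finset.range N, x k ^ 2 ≤ 3 + 3 * δ ^ 2 * K₁ ^ 2 * u k ^ 2 + 3 * B ^ 2 * Z ^ 2 := by
    intro k hk
    have hk' := Finset.mem_range.1 hk
    have := pow_le_pow_left₀ (hx0 k hk') (hx k hk') 2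
    nlinarith [sq_nonneg (1 - δ * K₁ * u k), sq_nonneg (1 - B * Z),
      sq_nonneg (δ * K₁ * u k - B * Z)]
  have h2 := Finset.sum_le_sum h1
  simp only [Finset.sum_add_distrib, ← Finset.mul_sum, Finset.sum_const, Finset.card_range,
    nsmul_eq_mul] at h2
  have h3 : ∀ k ∈ Finset.range N,
      z k ^ 2 ≤ δ ^ 4 * (2 * K₂ ^ 2 * u k ^ 2) + δ ^ 4 * (2 * K₃ ^ 2 * d k ^ 2) := by
    intro k hk
    have hk' := Finset.mem_range.1 hk
    have h4 := pow_le_pow_left₀ (hz0 k hk') (hz k hk') 2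
    have h5 := mul_le_mul_of_nonneg_left (add_sq_le (a := K₂ * u k) (b := K₃ * d k))
      (show 0 ≤ δ ^ 4 by positivity)
    nlinarith
  have h4 := Finset.sum_le_sum h3
  simp only [Finset.sum_add_distrib, ← Finset.mul_sum] at h4
  have h5 := sq_sum_range_le z N
  rw [← hZ] at h5
  have hNδ : (N * δ) ^ 2 ≤ c₂ ^ 2 := by gcongr
  have h6 : N * Z ^ 2 ≤ 2 * c₂ ^ 2 * (K₂ ^ 2 * (δ ^ 2 * U) + K₃ ^ 2 * (δ ^ 2 * D)) := by
    calc N * Z ^ 2 ≤ N * (N * (δ ^ 4 * (2 * K₂ ^ 2 * U) + δ ^ 4 * (2 * K₃ ^ 2 * D))) := by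
          have : (N : ℝ) * ∑ j ∈ Finset.range N, z j ^ 2
              ≤ N * (δ ^ 4 * (2 * K₂ ^ 2 * U) + δ ^ 4 * (2 * K₃ ^ 2 * D)) := by
            gcongr
          gcongr
          exact h5.trans this
      _ = (N * δ) ^ 2 * (2 * (K₂ ^ 2 * (δ ^ 2 * U) + K₃ ^ 2 * (δ ^ 2 * D))) := by ring
      _ ≤ c₂ ^ 2 * (2 * (K₂ ^ 2 * (δ ^ 2 * U) + K₃ ^ 2 * (δ ^ 2 * D))) := by gcongr
      _ = _ := by ring
  have h7 := mul_le_mul_of_nonneg_left h6 (show 0 ≤ 3 * B ^ 2 by positivity)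
  linarith

lemma sum_sq_norm_le_of_inverse {N : ℕ} {A : Matrix (Fin N) (Fin N) ℂ} {c₀ : ℝ} (hA : IsUnit A)
    (hc : l2OpNorm A⁻¹ ≤ c₀) (x : Fin N → ℂ) :
    ∑ j, ‖x j‖ ^ 2 ≤ c₀ ^ 2 * ∑ j, ‖(A.mulVec x) j‖ ^ 2 := by
  have h1 : Matrix.toEuclideanCLM (𝕜 := ℂ) A⁻¹ (WithLp.toLp 2 (A.mulVec x))
      = WithLp.toLp 2 x := by
    rw [Matrix.toEuclideanCLM_toLp, Matrix.mulVec_mulVec,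
      Matrix.nonsing_inv_mul A ((Matrix.isUnit_iff_isUnit_det A).1 hA), Matrix.one_mulVec]
  have h2 := (Matrix.toEuclideanCLM (𝕜 := ℂ) A⁻¹).le_of_opNorm_le hc
    (WithLp.toLp 2 (A.mulVec x))
  rw [h1] at h2
  have h3 := pow_le_pow_left₀ (norm_nonneg _) h2 2
  rw [mul_pow, EuclideanSpace.norm_sq_eq, EuclideanSpace.norm_sq_eq] at h3
  exact h3

lemma norm_residual_le {κ B δ : ℝ} {β : ℂ} {τ : ℕ → ℝ} {p q : ℕ → ℂ} {N m : ℕ} (hβ : ‖β‖ ≤ B)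
    (hτ : ∀ i j, i < j → j < N → τ i + δ ≤ τ j) (hδ : 0 < δ) (hm : m < N) :
    ‖p m - β * ∑ j ∈ Finset.range N, planeWave κ |τ m - τ j| * p j‖
      ≤ 1 + ‖(1 - β) * p m - (rightAmp κ β τ p q m + leftAmp κ β τ p q N m)‖
        + B * ∑ j ∈ Finset.range N, ‖q j‖ := by
  have hl : ∀ j ∈ Finset.range m,
      planeWave κ |τ m - τ j| * p j = planeWave κ (τ m - τ j) * p j := fun j hj => by
    rw [abs_of_nonneg (by linarith [hτ j m (Finset.mem_range.1 hj) hm])]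
  have hr : ∀ j ∈ Finset.Ico (m + 1) N,
      planeWave κ |τ m - τ j| * p j = planeWave κ (τ j - τ m) * p j := fun j hj => by
    have := hτ m j (Finset.mem_Ico.1 hj).1 (Finset.mem_Ico.1 hj).2
    rw [abs_of_nonpos (by linarith), neg_sub]
  have key : p m - β * ∑ j ∈ Finset.range N, planeWave κ |τ m - τ j| * p j
      = planeWave κ (τ m) + ((1 - β) * p m - (rightAmp κ β τ p q m + leftAmp κ β τ p q N m))
        + β * (Complex.I * (∑ j ∈ Finset.Ico (m + 1) N, planeWave κ (τ j - τ m) * q j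
          - ∑ j ∈ Finset.range m, planeWave κ (τ m - τ j) * q j)) := by
    have h1 : rightAmp κ β τ p q m = planeWave κ (τ m)
        + β * (∑ j ∈ Finset.range m, planeWave κ (τ m - τ j) * p j
          - Complex.I * ∑ j ∈ Finset.range m, planeWave κ (τ m - τ j) * q j) := by
      rw [rightAmp, Finset.mul_sum _ _ Complex.I, ← Finset.sum_sub_distrib]
      congr 2
      exact Finset.sum_congr rfl fun _ _ => by ring
    have h2 : leftAmp κ β τ p q N m = β * (∑ j ∈ Finset.Ico (m + 1) N, planeWave κ (τ j - τ m) * p j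
          + Complex.I * ∑ j ∈ Finset.Ico (m + 1) N, planeWave κ (τ j - τ m) * q j) := by
      rw [leftAmp, Finset.mul_sum _ _ Complex.I, ← Finset.sum_add_distrib]
      congr 1
      exact Finset.sum_congr rfl fun _ _ => by ring
    rw [sum_range_eq_add_Ico hm, Finset.sum_congr rfl hl, Finset.sum_congr rfl hr, h1, h2,
      sub_self, abs_zero, planeWave_zero]
    ring
  have h2 : ‖∑ j ∈ Finset.Ico (m + 1) N, planeWave κ (τ j - τ m) * q j‖
      ≤ ∑ j ∈ Finset.Ico (m + 1) N, ‖q j‖ := norm_sum_le_of_le _ fun j _ => by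
    rw [norm_mul, norm_planeWave, one_mul]
  have h3 : ‖∑ j ∈ Finset.range m, planeWave κ (τ m - τ j) * q j‖
      ≤ ∑ j ∈ Finset.range m, ‖q j‖ := norm_sum_le_of_le _ fun j _ => by
    rw [norm_mul, norm_planeWave, one_mul]
  have h4 : ‖∑ j ∈ Finset.Ico (m + 1) N, planeWave κ (τ j - τ m) * q j
          - ∑ j ∈ Finset.range m, planeWave κ (τ m - τ j) * q j‖
      ≤ ∑ j ∈ Finset.range N, ‖q j‖ := by
    rw [sum_range_eq_add_Ico hm]
    refine (norm_sub_le _ _).trans ?_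
    linarith [norm_nonneg (q m)]
  have h5 := mul_le_mul hβ h4 (norm_nonneg _) ((norm_nonneg β).trans hβ)
  rw [key]
  refine norm_add₃_le.trans ?_
  rw [norm_planeWave, norm_mul, norm_mul, Complex.norm_I, one_mul]
  gcongr

lemma le_of_absorbed_errors {U V Q P W N η c₀ κ b K₁ K₂ K₃ C₃ C₄ : ℝ}
    (hW : W ≤ 3 * N + 3 * K₁ ^ 2 * V + 6 * b * (K₂ ^ 2 * V + K₃ ^ 2 * Q))
    (hPW : P ≤ c₀ ^ 2 * W) (hUP : U ≤ 8 * P + 8 * κ ^ 2 * Q)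
    (hC₄ : C₄ = 24 * c₀ ^ 2 + 8 * c₀ ^ 2 * (3 * K₁ ^ 2) + 8 * c₀ ^ 2 * (6 * b * K₂ ^ 2)
      + (8 * c₀ ^ 2 * (6 * b * K₃ ^ 2) + 8 * κ ^ 2))
    (hb : 0 ≤ b) (hU0 : 0 ≤ U) (hV0 : 0 ≤ V) (hQ0 : 0 ≤ Q) (hN : 1 ≤ N)
    (hη0 : 0 ≤ η) (hV : V ≤ η * U) (hQ : Q ≤ C₃ * η * (1 + U))
    (hη : η * (2 * C₄ * (1 + C₃) + 1) ≤ 1) : U ≤ 2 * C₄ * N + N := by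
  have hC₄0 : 0 ≤ C₄ := by rw [hC₄]; positivity
  have hmain : U ≤ C₄ * (N + V + Q) := by
    have h1 := mul_le_mul_of_nonneg_left hW (show 0 ≤ 8 * c₀ ^ 2 by positivity)
    have h2 : U ≤ 24 * c₀ ^ 2 * N + (8 * c₀ ^ 2 * (3 * K₁ ^ 2)
        + 8 * c₀ ^ 2 * (6 * b * K₂ ^ 2)) * V
        + (8 * c₀ ^ 2 * (6 * b * K₃ ^ 2) + 8 * κ ^ 2) * Q := by
      linarith
    have h3 : 24 * c₀ ^ 2 * N ≤ C₄ * N := by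
      gcongr
      rw [hC₄]
      have : 0 ≤ 8 * c₀ ^ 2 * (3 * K₁ ^ 2) + 8 * c₀ ^ 2 * (6 * b * K₂ ^ 2)
        + (8 * c₀ ^ 2 * (6 * b * K₃ ^ 2) + 8 * κ ^ 2) := by positivity
      linarith
    have h4 : (8 * c₀ ^ 2 * (3 * K₁ ^ 2) + 8 * c₀ ^ 2 * (6 * b * K₂ ^ 2))
        * V ≤ C₄ * V := by
      refine mul_le_mul_of_nonneg_right ?_ hV0
      rw [hC₄]
      have : 0 ≤ 24 * c₀ ^ 2
        + (8 * c₀ ^ 2 * (6 * b * K₃ ^ 2) + 8 * κ ^ 2) := by positivity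
      linarith
    have h5 : (8 * c₀ ^ 2 * (6 * b * K₃ ^ 2) + 8 * κ ^ 2) * Q
        ≤ C₄ * Q := by
      refine mul_le_mul_of_nonneg_right ?_ hQ0
      rw [hC₄]
      have : 0 ≤ 24 * c₀ ^ 2 + 8 * c₀ ^ 2 * (3 * K₁ ^ 2)
        + 8 * c₀ ^ 2 * (6 * b * K₂ ^ 2) := by positivity
      linarith
    linarith
  have h1 : C₄ * (N + V + Q) ≤ C₄ * (N + η * U + C₃ * η * (1 + U)) := by
    gcongr
  have h2 : C₄ * (1 + C₃) * η ≤ 1 / 2 := by linarith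
  have h3 := mul_le_mul_of_nonneg_right h2 (show 0 ≤ 1 + U by positivity)
  have h4 : 0 ≤ C₄ * η := by positivity
  linarith

set_option maxHeartbeats 1000000 in
/-- A continuous solution of the Lippmann–Schwinger equation is bounded in mean square on the
intervals as soon as the discretised system is stable in `ℓ²`. -/
theorem exists_sum_sq_sup_le {κ T B c₀ c₂ : ℝ} (hκ : 0 < κ) (hT : 0 ≤ T) (hB : 0 ≤ B)
    (hc₂ : 0 < c₂) :
    ∃ δ₀ > 0, δ₀ ≤ 1 ∧ ∃ K > 0, ∀ δ, 0 < δ → δ < δ₀ → ∀ N : ℕ, N * δ ≤ c₂ →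
      ∀ (β : ℂ) (τ : ℕ → ℝ) (E : ℝ → ℂ) (u : ℕ → ℝ), ‖β‖ ≤ B →
      (∀ i j, i < j → j < N → ((j - i : ℕ) : ℝ) * δ ≤ τ j - τ i) →
      (∀ k, 0 ≤ τ k) → (∀ k, τ k ≤ T) → Continuous E →
      (∀ t, E t = planeWave κ t + β * ∑ k ∈ Finset.range N,
        windowMean δ fun v => planeWave κ |t - (τ k + v)| * E (τ k + v)) →
      (∀ p : ℕ → ℂ, ∑ k ∈ Finset.range N, ‖p k‖ ^ 2 ≤ c₀ ^ 2 * ∑ m ∈ Finset.range N,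
        ‖p m - β * ∑ j ∈ Finset.range N, planeWave κ |τ m - τ j| * p j‖ ^ 2) →
      (∀ k v, |v| ≤ δ / 2 → ‖E (τ k + v)‖ ≤ u k) →
      (∀ k, ∃ v, |v| ≤ δ / 2 ∧ ‖E (τ k + v)‖ = u k) →
      ∑ k ∈ Finset.range N, u k ^ 2 ≤ K * N := by
  set C₃ := 32 * (1 + 3 * B) ^ 2 / κ ^ 2 + 512 * B ^ 2
      + (κ * T + 1) * (4 + 16 * B ^ 2 * c₂) with hC₃
  set K₁ := κ * (1 + 3 * B) with hK₁
  set K₂ := κ ^ 2 * (1 + 2 * B) with hK₂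
  set K₃ := κ ^ 2 with hK₃
  set C₄ := 24 * c₀ ^ 2 + 8 * c₀ ^ 2 * (3 * K₁ ^ 2) + 8 * c₀ ^ 2 * (6 * (B ^ 2 * c₂ ^ 2) * K₂ ^ 2)
      + (8 * c₀ ^ 2 * (6 * (B ^ 2 * c₂ ^ 2) * K₃ ^ 2) + 8 * κ ^ 2) with hC₄
  have hC₃0 : 0 ≤ C₃ := by positivity
  have hC₄0 : 0 ≤ C₄ := by positivity
  set η₀ := min 1 (min (1 / (2 * C₄ * (1 + C₃) + 1)) (1 / (2 * (κ * (2 + 2 * B)))))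
  have hη₀pos : 0 < η₀ := by positivity
  refine ⟨η₀ ^ 2, by positivity, pow_le_one₀ hη₀pos.le (min_le_left _ _), 2 * C₄ + 1,
    by positivity, ?_⟩
  intro δ hδ hδ₀ N hNδ β τ E u hβ hτ hτ0 hτT hE hLS hinv hu hu_att
  rcases Nat.eq_zero_or_pos N with rfl | hN
  · simp
  have hN1 : (1 : ℝ) ≤ N := by exact_mod_cast hN
  set η := Real.sqrt δ
  have hηsq : η ^ 2 = δ := Real.sq_sqrt hδ.le
  have hηpos : 0 < η := Real.sqrt_pos.2 hδ
  have hηη₀ : η < η₀ := (Real.sqrt_lt' hη₀pos).2 hδ₀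
  have hη1 : η ≤ 1 := hηη₀.le.trans (min_le_left _ _)
  have hη2 : η * (2 * C₄ * (1 + C₃) + 1) ≤ 1 := by
    rw [← le_div_iff₀ (by positivity)]
    exact hηη₀.le.trans ((min_le_right _ _).trans (min_le_left _ _))
  have hη3 : η * (2 * (κ * (2 + 2 * B))) ≤ 1 := by
    rw [← le_div_iff₀ (by positivity)]
    exact hηη₀.le.trans ((min_le_right _ _).trans (min_le_right _ _))
  have hδη : δ ≤ η := by rw [← hηsq]; nlinarith
  have hδ1 : δ ≤ 1 := hδη.trans hη1
  have hsmall : κ * δ * (2 + 2 * B) ≤ 1 / 2 := by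
    have : δ * (κ * (2 + 2 * B)) ≤ η * (κ * (2 + 2 * B)) := by gcongr
    linarith
  have hu0 : ∀ k, 0 ≤ u k := fun k => nonneg_of_window_bound hδ (hu k)
  set F : ℕ → ℝ → ℂ := fun k v => E (τ k + v) with hF
  have hFc : ∀ k, Continuous (F k) := fun k => by simp only [hF]; fun_prop
  set p : ℕ → ℂ := fun k => cosMoment κ δ (F k)
  set q : ℕ → ℂ := fun k => sinMoment κ δ (F k)
  set a : ℕ → ℂ := rightAmp κ β τ p q
  set b : ℕ → ℂ := leftAmp κ β τ p q N
  set d : ℕ → ℝ := fun k => ‖a k - b k‖ with hd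
  have hsep : ∀ i j, i < j → j < N → τ i + δ ≤ τ j := fun i j hij hj => by
    have h1 := hτ i j hij hj
    have h2 : (1 : ℝ) ≤ ((j - i : ℕ) : ℝ) := by exact_mod_cast Nat.sub_pos_of_lt hij
    nlinarith only [h1, h2, hδ]
  have hloc : ∀ k < N, ∀ v, |v| ≤ δ / 2 → F k v = planeWave κ v * a k + planeWave κ (-v) * b k
      + β * windowMean δ fun w => planeWave κ |v - w| * F k w := fun k hk v hv =>
    field_on_window hE hδ hsep hLS (fun _ => rfl) (fun _ => rfl) hk hv
  have hpu : ∀ k, ‖p k‖ ≤ u k := fun k => norm_cosMoment_le hδ (hu k)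
  have hqu : ∀ k, ‖q k‖ ≤ u k := fun k => norm_sinMoment_le hδ (hu k)
  have hqκ : ∀ k, ‖q k‖ ≤ κ * δ * u k := fun k => norm_sinMoment_le_mul hκ hδ (hu k)
  have hs : ∀ k < N, ‖a k + b k‖ ≤ (1 + B) * u k := fun k hk =>
    norm_incoming_sum_le hδ (hu k) hβ (hloc k hk)
  have hz : ∀ k < N, ‖q k‖ ≤ δ ^ 2 * (K₂ * u k + K₃ * d k) := fun k hk =>
    (norm_sinMoment_le_sq hκ hδ (hu k) hβ (hFc k) (hloc k hk)).trans_eq (by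
      simp only [hK₂, hK₃, hd]; ring)
  have hup : ∀ k < N, u k ≤ 2 * ‖p k‖ + 2 * κ * δ * d k := by
    intro k hk
    obtain ⟨v, hv, hvu⟩ := hu_att k
    have h1 := norm_le_cosMoment hκ hδ (hu k) hβ (hFc k) (hloc k hk) hv
    rw [show ‖F k v‖ = u k from hvu] at h1
    have h2 := mul_le_mul_of_nonneg_right hsmall (hu0 k)
    have h3 : d k = ‖a k - b k‖ := rfl
    have h4 : ‖p k‖ = ‖cosMoment κ δ (F k)‖ := rfl
    rw [h3, h4]
    linarith only [h1, h2]
  set U := ∑ k ∈ Finset.range N, u k ^ 2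
  set D := ∑ k ∈ Finset.range N, d k ^ 2
  set P := ∑ k ∈ Finset.range N, ‖p k‖ ^ 2
  have hU0 : 0 ≤ U := Finset.sum_nonneg fun _ _ => sq_nonneg _
  have hD0 : 0 ≤ D := Finset.sum_nonneg fun _ _ => sq_nonneg _
  have hUP : U ≤ 8 * P + 8 * κ ^ 2 * (δ ^ 2 * D) := by
    have h1 : ∀ k ∈ Finset.range N,
        u k ^ 2 ≤ 8 * ‖p k‖ ^ 2 + 8 * κ ^ 2 * δ ^ 2 * d k ^ 2 := by
      intro k hk
      have h2 := pow_le_pow_left₀ (hu0 k) (hup k (Finset.mem_range.1 hk)) 2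
      nlinarith only [h2, sq_nonneg (2 * ‖p k‖ - 2 * κ * δ * d k)]
    have h2 := Finset.sum_le_sum h1
    simp only [Finset.sum_add_distrib, ← Finset.mul_sum] at h2
    linarith only [h2]
  set x : ℕ → ℝ := fun m =>
    ‖p m - β * ∑ j ∈ Finset.range N, planeWave κ |τ m - τ j| * p j‖ with hx
  have hxle : ∀ m < N, x m ≤ 1 + δ * K₁ * u m + B * ∑ j ∈ Finset.range N, ‖q j‖ := by
    intro m hm
    refine (norm_residual_le (q := q) hβ hsep hδ hm).trans ?_
    have h1 := norm_cosMoment_sub_incoming_le hκ hδ (hu m) hβ (hFc m) (hloc m hm)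
    have h2 : κ * δ * ((1 + 3 * B) * u m) = δ * K₁ * u m := by rw [hK₁]; ring
    rw [h2] at h1
    gcongr
  have hW := sum_sq_residual_le (x := x) (z := fun j => ‖q j‖) (u := u) (d := d)
    (fun _ _ => norm_nonneg _) (fun _ _ => norm_nonneg _) hxle hz hδ.le hNδ
  have hPW : P ≤ c₀ ^ 2 * ∑ m ∈ Finset.range N, x m ^ 2 := hinv p
  have hdcrude : ∀ m < N, d m ^ 2 ≤ 2 + 8 * B ^ 2 * (N * U) := by
    intro m hm
    have h1 := pow_le_pow_left₀ (norm_nonneg _)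
      (norm_incoming_diff_le_crude (τ := τ) (κ := κ) hβ hpu hqu hm) 2
    have h2 := sq_sum_range_le u N
    have h3 := mul_le_mul_of_nonneg_left h2 (show 0 ≤ 8 * B ^ 2 by positivity)
    refine h1.trans ?_
    nlinarith only [h3, sq_nonneg (1 - 2 * B * ∑ j ∈ Finset.range N, u j)]
  set M := ⌈1 / η⌉₊
  have hMpos : 0 < M := Nat.ceil_pos.2 (by positivity)
  have hM1 : 1 / η ≤ M := Nat.le_ceil _
  have hM2 : (M : ℝ) ≤ 2 / η := by
    have h1 := (Nat.ceil_lt_add_one (show 0 ≤ 1 / η by positivity)).le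
    have h2 : 1 ≤ 1 / η := by rwa [le_div_iff₀ hηpos, one_mul]
    have h3 : 2 / η = 1 / η + 1 / η := by ring
    linarith only [h1, h2, h3]
  have hDle := sum_sq_le_of_shift_bound (u := u) (d := d) (τ := τ) (N := N) (M := M)
    (X := 2 * (1 + 3 * B) / (κ * (M * η ^ 2))) (Y := 8 * B) hκ.le
    (R := 2 + 8 * B ^ 2 * (N * U)) (by positivity) hT (fun _ => norm_nonneg _) hτ0 hτT
    (fun m hm => by linarith only [hδ, hsep m (m + M) (by omega) hm])
    (fun m hm hnear => by
      rw [hηsq]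
      exact norm_incoming_diff_le hκ hδ hβ hpu hqu hMpos hm hτ hqκ hs hnear)
    hdcrude
  have hDη : η ^ 4 * D ≤ C₃ * η * (1 + U) :=
    shift_bound_rescaled hκ hT hB hηpos hη1 hM1 hM2 hU0 (by rwa [hηsq]) hDle (by positivity)
  have hδ2 : δ ^ 2 * U ≤ η * U := by
    gcongr
    exact (pow_le_of_le_one hδ.le hδ1 two_ne_zero).trans hδη
  have hδD : δ ^ 2 * D ≤ C₃ * η * (1 + U) := by
    rwa [show η ^ 4 = δ ^ 2 by rw [← hηsq]; ring] at hDη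
  have hδU0 : 0 ≤ δ ^ 2 * U := by positivity
  have hδD0 : 0 ≤ δ ^ 2 * D := by positivity
  rw [add_mul, one_mul]
  exact le_of_absorbed_errors hW hPW hUP hC₄ (by positivity) hU0 hδU0 hδD0 hN1 hηpos.le hδ2 hδD
    hη2

lemma add_le_of_disjoint_Ioo {x y δ : ℝ} (hxy : x < y)
    (h : Disjoint (Set.Ioo (x - δ / 2) (x + δ / 2)) (Set.Ioo (y - δ / 2) (y + δ / 2))) :
    x + δ ≤ y := by
  by_contra! hlt
  have hx : (x + y) / 2 ∈ Set.Ioo (x - δ / 2) (x + δ / 2) := ⟨by linarith, by linarith⟩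
  exact Set.disjoint_left.1 h hx ⟨by linarith, by linarith⟩

lemma mul_le_sub_of_consecutive {τ : ℕ → ℝ} {N : ℕ} {δ : ℝ}
    (h : ∀ i, i + 1 < N → τ i + δ ≤ τ (i + 1)) (i n : ℕ) (hn : i + n < N) :
    n * δ ≤ τ (i + n) - τ i := by
  induction n with
  | zero => simp
  | succ n ih =>
    have h1 := ih (by omega)
    have h2 := h (i + n) hn
    rw [add_assoc] at h2
    push_cast
    linarith

lemma L2normOn_le {x δ K : ℝ} {E : ℝ → ℂ} (hδ : 0 < δ)
    (hu : ∀ v, |v| ≤ δ / 2 → ‖E (x + v)‖ ≤ K) :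
    L2normOn (x - δ / 2) (x + δ / 2) E ≤ Real.sqrt δ * K := by
  have hK := nonneg_of_window_bound hδ hu
  have h : ∫ s in Set.Ioo (x - δ / 2) (x + δ / 2), ‖E s‖ ^ 2 ≤ δ * K ^ 2 := by
    have h1 := norm_setIntegral_le_of_norm_le_const (μ := volume)
      (s := Set.Ioo (x - δ / 2) (x + δ / 2)) (f := fun s => ‖E s‖ ^ 2) (C := K ^ 2)
      (by rw [Real.volume_Ioo]; exact ENNReal.ofReal_lt_top) fun s hs => by
        rw [Real.norm_eq_abs, abs_of_nonneg (by positivity)]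
        have := hu (s - x) (abs_le.2 ⟨by linarith [hs.1], by linarith [hs.2]⟩)
        rw [add_sub_cancel] at this
        gcongr
    rw [Real.volume_real_Ioo_of_le (by linarith)] at h1
    refine (le_abs_self _).trans (h1.trans_eq ?_)
    ring
  rw [L2normOn]
  refine (Real.sqrt_le_sqrt h).trans_eq ?_
  rw [Real.sqrt_mul hδ.le, Real.sqrt_sq hK]

theorem stmt5 (κ C T h l c₀ c₁ c₂ : ℝ) (hκ : 0 < κ) (hC : 0 < C) (hT : 0 < T)
    (hh : h ∈ Set.Ioc (0 : ℝ) 1) (hl : l ∈ Set.Ioc (0 : ℝ) 1)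
    (hc₀ : 0 < c₀) (hc₁ : 0 < c₁) (hc₂ : 0 < c₂) :
    ∃ δ₀ > 0, ∃ c > 0, ∀ δ ∈ Set.Ioo (0 : ℝ) δ₀, ∀ N : ℕ,
      (N : ℝ) ≤ c₂ * δ ^ (-l) →
      ∀ Tc : Fin N → ℝ, StrictMono Tc →
      (∀ j, Set.Ioo (Tc j - δ / 2) (Tc j + δ / 2) ⊆ Set.Ioo 0 T) →
      (Pairwise fun i j =>
        Disjoint (Set.Ioo (Tc i - δ / 2) (Tc i + δ / 2))
          (Set.Ioo (Tc j - δ / 2) (Tc j + δ / 2))) →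
      (∀ i j : Fin N, (j : ℕ) = (i : ℕ) + 1 → c₁ * δ ^ l ≤ Tc j - Tc i) →
      IsUnit (Abar κ C δ h Tc) →
      l2OpNorm (Abar κ C δ h Tc)⁻¹ ≤ c₀ →
      ∀ E : ℝ → ℂ, IsTotalField κ C δ h Tc E →
      ∑ j, L2normOn (Tc j - δ / 2) (Tc j + δ / 2) E ≤ c * δ ^ ((1 : ℝ) / 2) * N := by
  set B := C / (2 * κ) with hB
  have hB0 : 0 ≤ B := by positivity
  obtain ⟨δ₀, hδ₀, hδ₀1, K, hK, hmain⟩ :=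
    exists_sum_sq_sup_le (c₀ := c₀) hκ hT.le hB0 hc₂
  refine ⟨δ₀, hδ₀, Real.sqrt K, Real.sqrt_pos.2 hK, ?_⟩
  rintro δ ⟨hδ, hδδ₀⟩ N hN Tc hmono hsub hdisj - hunit hinv E ⟨hE, hLS⟩
  have hδ1 : δ ≤ 1 := hδδ₀.le.trans hδ₀1
  have hNδ : N * δ ≤ c₂ := by
    have h1 : δ ^ (-l) ≤ δ ^ (-1 : ℝ) :=
      Real.rpow_le_rpow_of_exponent_ge hδ hδ1 (by linarith [hl.2])
    rw [Real.rpow_neg_one] at h1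
    rw [← le_div_iff₀ hδ, div_eq_mul_inv]
    exact hN.trans (by gcongr)
  set β : ℂ := Complex.I * ((C * δ ^ (1 - h) : ℝ) : ℂ) / (2 * κ) with hβdef
  have hβ : ‖β‖ ≤ B := by
    have h1 : δ ^ (1 - h) ≤ 1 := Real.rpow_le_one hδ.le hδ1 (by linarith [hh.2])
    have h2 : 0 ≤ C * δ ^ (1 - h) := by positivity
    rw [hβdef, norm_div, norm_mul, norm_mul, Complex.norm_I, one_mul, Complex.norm_real,
      Complex.norm_real, Complex.norm_ofNat, Real.norm_of_nonneg h2, Real.norm_of_nonneg hκ.le]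
    rw [hB]
    gcongr
    nlinarith
  set τ : ℕ → ℝ := fun k => if hk : k < N then Tc ⟨k, hk⟩ else T with hτdef
  have hτ : ∀ j : Fin N, τ j = Tc j := fun j => by simp [hτdef]
  have hTc : ∀ j, Tc j ∈ Set.Ioo 0 T := fun j => hsub j ⟨by linarith, by linarith⟩
  have hτ0 : ∀ k, 0 ≤ τ k := fun k => by
    simp only [hτdef]
    split_ifs
    exacts [(hTc _).1.le, hT.le]
  have hτT : ∀ k, τ k ≤ T := fun k => by
    simp only [hτdef]
    split_ifs
    exacts [(hTc _).2.le, le_rfl]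
  have hstep : ∀ i, i + 1 < N → τ i + δ ≤ τ (i + 1) := fun i hi => by
    have hlt : (⟨i, by omega⟩ : Fin N) < ⟨i + 1, hi⟩ := Fin.mk_lt_mk.2 (Nat.lt_succ_self i)
    rw [show τ i = Tc ⟨i, by omega⟩ from hτ ⟨i, by omega⟩,
      show τ (i + 1) = Tc ⟨i + 1, hi⟩ from hτ ⟨i + 1, hi⟩]
    exact add_le_of_disjoint_Ioo (hmono hlt) (hdisj hlt.ne)
  have hsep : ∀ i j, i < j → j < N → ((j - i : ℕ) : ℝ) * δ ≤ τ j - τ i := fun i j hij hj => by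
    have := mul_le_sub_of_consecutive hstep i (j - i) (by omega)
    rwa [Nat.add_sub_cancel' hij.le] at this
  have hLS' : ∀ t, E t = planeWave κ t + β * ∑ k ∈ Finset.range N,
      windowMean δ fun v => planeWave κ |t - (τ k + v)| * E (τ k + v) := by
    intro t
    have h1 := hLS t
    have h2 : ∀ j : Fin N, ((C * δ ^ (-h) : ℝ) : ℂ) *
        ∫ s in Set.Ioo (Tc j - δ / 2) (Tc j + δ / 2), Phi κ t s * E s
        = β * windowMean δ fun v => planeWave κ |t - (τ j + v)| * E (τ j + v) := by
      intro j
      have h3 : (fun v => Phi κ t (Tc j + v) * E (Tc j + v)) = fun v =>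
          Complex.I / (2 * κ) * (planeWave κ |t - (Tc j + v)| * E (Tc j + v)) := by
        ext v
        rw [Phi, planeWave]
        ring
      have h4 : δ ^ (1 - h) = δ ^ (-h) * δ := by
        rw [sub_eq_neg_add, Real.rpow_add hδ, Real.rpow_one]
      rw [setIntegral_Ioo_eq_windowMean hδ, h3, windowMean_const_mul, hτ, hβdef, h4]
      push_cast
      ring
    rw [Finset.mul_sum, Finset.sum_congr rfl fun j _ => h2 j, ← Finset.mul_sum] at h1
    rw [Finset.sum_range, planeWave]
    linear_combination h1
  have hstable : ∀ p : ℕ → ℂ, ∑ k ∈ Finset.range N, ‖p k‖ ^ 2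
      ≤ c₀ ^ 2 * ∑ m ∈ Finset.range N,
        ‖p m - β * ∑ j ∈ Finset.range N, planeWave κ |τ m - τ j| * p j‖ ^ 2 := by
    intro p
    have h1 := sum_sq_norm_le_of_inverse hunit hinv fun j => p j
    have h2 : ∀ m : Fin N, (Abar κ C δ h Tc).mulVec (fun j => p j) m
        = p m - β * ∑ j ∈ Finset.range N, planeWave κ |τ m - τ j| * p j := by
      intro m
      simp only [Matrix.mulVec, dotProduct, Abar, ← hβdef, sub_mul, Finset.sum_sub_distrib,
        ite_mul, one_mul, zero_mul, Finset.sum_ite_eq, Finset.mem_univ, if_true]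
      rw [Finset.sum_range, Finset.mul_sum]
      congr 1
      refine Finset.sum_congr rfl fun j _ => ?_
      rw [hτ, hτ, planeWave, mul_assoc]
    rw [Finset.sum_range, Finset.sum_range]
    simpa only [h2] using h1
  have hmax : ∀ k, ∃ v₀, |v₀| ≤ δ / 2 ∧
      ∀ v, |v| ≤ δ / 2 → ‖E (τ k + v)‖ ≤ ‖E (τ k + v₀)‖ := fun k => by
    obtain ⟨v₀, hv₀, hv₀max⟩ := (isCompact_Icc (a := -(δ / 2)) (b := δ / 2)).exists_isMaxOn
      ⟨0, by constructor <;> linarith⟩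
      (f := fun v => ‖E (τ k + v)‖) (by fun_prop)
    exact ⟨v₀, abs_le.2 hv₀, fun v hv => hv₀max (abs_le.1 hv)⟩
  choose v₀ hv₀ hv₀max using hmax
  set u : ℕ → ℝ := fun k => ‖E (τ k + v₀ k)‖
  have hU := hmain δ hδ hδδ₀ N hNδ β τ E u hβ hsep hτ0 hτT hE hLS' hstable hv₀max
    fun k => ⟨v₀ k, hv₀ k, rfl⟩
  have hsum : ∑ k ∈ Finset.range N, u k ≤ Real.sqrt K * N := by
    refine abs_le_of_sq_le_sq' ?_ (by positivity) |>.2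
    rw [mul_pow, Real.sq_sqrt hK.le]
    refine (sq_sum_range_le u N).trans ?_
    nlinarith [mul_le_mul_of_nonneg_left hU (Nat.cast_nonneg (α := ℝ) N)]
  calc ∑ j, L2normOn (Tc j - δ / 2) (Tc j + δ / 2) E
      ≤ ∑ j : Fin N, Real.sqrt δ * u j := Finset.sum_le_sum fun j _ => by
        rw [← hτ]
        exact L2normOn_le hδ (hv₀max j)
    _ = Real.sqrt δ * ∑ k ∈ Finset.range N, u k := by
        rw [Finset.sum_range, Finset.mul_sum]
    _ ≤ Real.sqrt δ * (Real.sqrt K * N) := by gcongr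
    _ = _ := by rw [← Real.sqrt_eq_rpow]; ring
end

section
/- Let κ>0, M>0, T>0. The effective field u_eff satisfies the Lippmann–Schwinger integral equation u_eff(t) − M ∫₀^T (i/(2κ)) e^{iκ|t−s|} u_eff(s) ds = e^{iκt} for every t ∈ ℝ. -/
open MeasureTheory

/-- `λ = √(κ² + M)`. -/
noncomputable def lamEff (κ M : ℝ) : ℝ := Real.sqrt (κ ^ 2 + M)

/-- `D = (λ+κ)² e^{−iλT} − (λ−κ)² e^{iλT}`. -/
noncomputable def Dcoef (κ M T : ℝ) : ℂ :=
  ((lamEff κ M + κ : ℝ) : ℂ) ^ 2 * Complex.exp (-(Complex.I * lamEff κ M * T)) -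
    ((lamEff κ M - κ : ℝ) : ℂ) ^ 2 * Complex.exp (Complex.I * lamEff κ M * T)

/-- Reflection coefficient `C₂ = (λ²−κ²)(e^{iλT}−e^{−iλT})/D`. -/
noncomputable def C2coef (κ M T : ℝ) : ℂ :=
  ((lamEff κ M ^ 2 - κ ^ 2 : ℝ) : ℂ) *
    (Complex.exp (Complex.I * lamEff κ M * T) - Complex.exp (-(Complex.I * lamEff κ M * T))) /
      Dcoef κ M T

/-- `C₃ = 2κ(λ+κ)e^{−iλT}/D`. -/
noncomputable def C3coef (κ M T : ℝ) : ℂ :=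
  ((2 * κ * (lamEff κ M + κ) : ℝ) : ℂ) * Complex.exp (-(Complex.I * lamEff κ M * T)) /
    Dcoef κ M T

/-- `C₄ = 2κ(λ−κ)e^{iλT}/D`. -/
noncomputable def C4coef (κ M T : ℝ) : ℂ :=
  ((2 * κ * (lamEff κ M - κ) : ℝ) : ℂ) * Complex.exp (Complex.I * lamEff κ M * T) /
    Dcoef κ M T

/-- Transmission coefficient `C₅ = 4κλ e^{−iκT}/D`. -/
noncomputable def C5coef (κ M T : ℝ) : ℂ :=
  ((4 * κ * lamEff κ M : ℝ) : ℂ) * Complex.exp (-(Complex.I * κ * T)) / Dcoef κ M T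

/-- The effective field `u_eff`. -/
noncomputable def ueff (κ M T t : ℝ) : ℂ :=
  if t < 0 then
    Complex.exp (Complex.I * κ * t) + C2coef κ M T * Complex.exp (-(Complex.I * κ * t))
  else if t ≤ T then
    C3coef κ M T * Complex.exp (Complex.I * lamEff κ M * t) +
      C4coef κ M T * Complex.exp (-(Complex.I * lamEff κ M * t))
  else
    C5coef κ M T * Complex.exp (Complex.I * κ * t)

/-- The field inside the slab is `C₃ e^{iλt} + C₄ e^{−iλt}`. -/
noncomputable def slabField (κ M T t : ℝ) : ℂ :=
  C3coef κ M T * Complex.exp (Complex.I * lamEff κ M * t) +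
    C4coef κ M T * Complex.exp (-(Complex.I * lamEff κ M * t))

/-- The derivative of `slabField`. -/
noncomputable def slabFieldDeriv (κ M T t : ℝ) : ℂ :=
  Complex.I * lamEff κ M * (C3coef κ M T * Complex.exp (Complex.I * lamEff κ M * t) -
    C4coef κ M T * Complex.exp (-(Complex.I * lamEff κ M * t)))

lemma hasDerivAt_cexp_mul_ofReal (c : ℂ) (t : ℝ) :
    HasDerivAt (fun x : ℝ => Complex.exp (c * x)) (c * Complex.exp (c * t)) t := by
  simpa [mul_comm] using ((Complex.ofRealCLM.hasDerivAt (x := t)).const_mul c).cexp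

lemma lamEff_sq {κ M : ℝ} (hM : 0 < M) : lamEff κ M ^ 2 = κ ^ 2 + M :=
  Real.sq_sqrt (by positivity)

lemma lamEff_pos {κ M : ℝ} (hM : 0 < M) : 0 < lamEff κ M :=
  Real.sqrt_pos.2 (by positivity)

lemma Dcoef_ne_zero {κ M : ℝ} (T : ℝ) (hκ : 0 < κ) (hM : 0 < M) : Dcoef κ M T ≠ 0 := by
  intro h
  have hl := lamEff_pos (κ := κ) hM
  have h' := congrArg norm (sub_eq_zero.1 h)
  have e1 : ‖Complex.exp (-(Complex.I * lamEff κ M * T))‖ = 1 := by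
    simp [Complex.norm_exp]
  have e2 : ‖Complex.exp (Complex.I * lamEff κ M * T)‖ = 1 := by
    simp [Complex.norm_exp]
  rw [norm_mul, norm_mul, e1, e2, norm_pow, norm_pow, Complex.norm_real, Complex.norm_real,
    Real.norm_eq_abs, Real.norm_eq_abs, sq_abs, sq_abs] at h'
  nlinarith [mul_pos hl hκ]

lemma cexp_neg_mul_cexp (z : ℂ) : Complex.exp (-z) * Complex.exp z = 1 := by
  rw [← Complex.exp_add, neg_add_cancel, Complex.exp_zero]

lemma hasDerivAt_slabField (κ M T t : ℝ) :
    HasDerivAt (slabField κ M T) (slabFieldDeriv κ M T t) t := by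
  have h1 := (hasDerivAt_cexp_mul_ofReal (Complex.I * lamEff κ M) t).const_mul (C3coef κ M T)
  have h2 := (hasDerivAt_cexp_mul_ofReal (-(Complex.I * lamEff κ M)) t).const_mul (C4coef κ M T)
  simp only [neg_mul] at h2
  refine (h1.add h2).congr_deriv ?_
  rw [slabFieldDeriv]
  ring

lemma hasDerivAt_slabFieldDeriv (κ M T t : ℝ) (hM : 0 < M) :
    HasDerivAt (slabFieldDeriv κ M T) (-((κ : ℂ) ^ 2 + M) * slabField κ M T t) t := by
  have h1 := (hasDerivAt_cexp_mul_ofReal (Complex.I * lamEff κ M) t).const_mul (C3coef κ M T)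
  have h2 := (hasDerivAt_cexp_mul_ofReal (-(Complex.I * lamEff κ M)) t).const_mul (C4coef κ M T)
  simp only [neg_mul] at h2
  refine ((h1.sub h2).const_mul (Complex.I * lamEff κ M)).congr_deriv ?_
  have hl : (lamEff κ M : ℂ) ^ 2 = (κ : ℂ) ^ 2 + M := by exact_mod_cast lamEff_sq hM
  rw [slabField, ← hl]
  linear_combination ((lamEff κ M : ℂ) ^ 2 *
    (C3coef κ M T * Complex.exp (Complex.I * lamEff κ M * t) +
    C4coef κ M T * Complex.exp (-(Complex.I * lamEff κ M * t)))) * Complex.I_sq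

lemma continuous_slabField (κ M T : ℝ) : Continuous (slabField κ M T) := by
  unfold slabField
  fun_prop

/-- Integrating the slab field against `e^{cs}`, where `c² = −κ²`. -/
lemma mul_integral_cexp_mul_slabField (κ M T a b : ℝ) (hM : 0 < M) {c : ℂ}
    (hc : c ^ 2 = -(κ : ℂ) ^ 2) :
    (M : ℂ) * ∫ s in a..b, Complex.exp (c * s) * slabField κ M T s =
      Complex.exp (c * a) * (slabFieldDeriv κ M T a - c * slabField κ M T a) -
        Complex.exp (c * b) * (slabFieldDeriv κ M T b - c * slabField κ M T b) := by
  have hd : ∀ x ∈ Set.uIcc a b, HasDerivAt (fun s : ℝ => -(Complex.exp (c * s) *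
      (slabFieldDeriv κ M T s - c * slabField κ M T s)))
      (M * (Complex.exp (c * x) * slabField κ M T x)) x := by
    intro x _
    refine ((hasDerivAt_cexp_mul_ofReal c x).mul ((hasDerivAt_slabFieldDeriv κ M T x hM).sub
      ((hasDerivAt_slabField κ M T x).const_mul c))).neg.congr_deriv ?_
    simp only [Pi.sub_apply]
    linear_combination (Complex.exp (c * x) * slabField κ M T x) * hc
  have hcont := continuous_slabField κ M T
  rw [← intervalIntegral.integral_const_mul, intervalIntegral.integral_eq_sub_of_hasDerivAt hd
    (Continuous.intervalIntegrable (by fun_prop) _ _)]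
  ring

lemma slabField_zero (κ M T : ℝ) (hκ : 0 < κ) (hM : 0 < M) :
    slabField κ M T 0 = 1 + C2coef κ M T := by
  have hD := Dcoef_ne_zero T hκ hM
  simp only [slabField, C2coef, C3coef, C4coef, Complex.ofReal_zero, mul_zero, neg_zero,
    Complex.exp_zero]
  field_simp
  rw [Dcoef]
  push_cast
  ring

lemma slabFieldDeriv_zero (κ M T : ℝ) (hκ : 0 < κ) (hM : 0 < M) :
    slabFieldDeriv κ M T 0 + Complex.I * κ * slabField κ M T 0 = 2 * Complex.I * κ := by
  have hD := Dcoef_ne_zero T hκ hM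
  simp only [slabField, slabFieldDeriv, C3coef, C4coef, Complex.ofReal_zero, mul_zero, neg_zero,
    Complex.exp_zero]
  field_simp
  rw [Dcoef]
  push_cast
  ring

lemma slabField_right (κ M T : ℝ) :
    slabField κ M T T = C5coef κ M T * Complex.exp (Complex.I * κ * T) := by
  have h1 := cexp_neg_mul_cexp (Complex.I * lamEff κ M * T)
  have h2 := cexp_neg_mul_cexp (Complex.I * κ * T)
  simp only [slabField, C3coef, C4coef, C5coef]
  push_cast
  linear_combination (4 * (κ : ℂ) * lamEff κ M / Dcoef κ M T) * (h1 - h2)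

lemma slabFieldDeriv_right (κ M T : ℝ) :
    slabFieldDeriv κ M T T - Complex.I * κ * slabField κ M T T = 0 := by
  simp only [slabField, slabFieldDeriv, C3coef, C4coef]
  push_cast
  ring

lemma integral_greens_of_ge (κ M T a b t : ℝ) (hM : 0 < M) (hab : a ≤ b)
    (hbt : b ≤ t) :
    (M : ℂ) * ∫ s in a..b,
        Complex.I / (2 * κ) * Complex.exp (Complex.I * κ * |t - s|) * slabField κ M T s =
      Complex.I / (2 * κ) * (
        Complex.exp (Complex.I * κ * (t - a)) *
          (slabFieldDeriv κ M T a + Complex.I * κ * slabField κ M T a) -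
        Complex.exp (Complex.I * κ * (t - b)) *
          (slabFieldDeriv κ M T b + Complex.I * κ * slabField κ M T b)) := by
  have he (s : ℝ) : Complex.exp (Complex.I * κ * (t - s)) =
      Complex.exp (Complex.I * κ * t) * Complex.exp (-(Complex.I * κ) * s) := by
    rw [← Complex.exp_add]
    ring_nf
  have hint := mul_integral_cexp_mul_slabField κ M T a b hM (c := -(Complex.I * κ))
    (by rw [neg_sq, mul_pow, Complex.I_sq]; ring)
  have hcongr : ∫ s in a..b,
      Complex.I / (2 * κ) * Complex.exp (Complex.I * κ * |t - s|) * slabField κ M T s =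
      ∫ s in a..b, Complex.I / (2 * κ) * Complex.exp (Complex.I * κ * t) *
        (Complex.exp (-(Complex.I * κ) * s) * slabField κ M T s) := by
    refine intervalIntegral.integral_congr fun s hs => ?_
    rw [Set.uIcc_of_le hab] at hs
    simp only [abs_of_nonneg (sub_nonneg.2 (hs.2.trans hbt)), Complex.ofReal_sub, he]
    ring
  rw [hcongr, intervalIntegral.integral_const_mul, he, he]
  linear_combination (Complex.I / (2 * κ) * Complex.exp (Complex.I * κ * t)) * hint

lemma integral_greens_of_le (κ M T a b t : ℝ) (hM : 0 < M) (hab : a ≤ b)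
    (hta : t ≤ a) :
    (M : ℂ) * ∫ s in a..b,
        Complex.I / (2 * κ) * Complex.exp (Complex.I * κ * |t - s|) * slabField κ M T s =
      Complex.I / (2 * κ) * (
        Complex.exp (Complex.I * κ * (a - t)) *
          (slabFieldDeriv κ M T a - Complex.I * κ * slabField κ M T a) -
        Complex.exp (Complex.I * κ * (b - t)) *
          (slabFieldDeriv κ M T b - Complex.I * κ * slabField κ M T b)) := by
  have he (s : ℝ) : Complex.exp (Complex.I * κ * (s - t)) =
      Complex.exp (-(Complex.I * κ * t)) * Complex.exp (Complex.I * κ * s) := by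
    rw [← Complex.exp_add]
    ring_nf
  have hint := mul_integral_cexp_mul_slabField κ M T a b hM (c := Complex.I * κ)
    (by rw [mul_pow, Complex.I_sq]; ring)
  have hcongr : ∫ s in a..b,
      Complex.I / (2 * κ) * Complex.exp (Complex.I * κ * |t - s|) * slabField κ M T s =
      ∫ s in a..b, Complex.I / (2 * κ) * Complex.exp (-(Complex.I * κ * t)) *
        (Complex.exp (Complex.I * κ * s) * slabField κ M T s) := by
    refine intervalIntegral.integral_congr fun s hs => ?_
    rw [Set.uIcc_of_le hab] at hs
    simp only [abs_of_nonpos (sub_nonpos.2 (hta.trans hs.1)), neg_sub, Complex.ofReal_sub, he]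
    ring
  rw [hcongr, intervalIntegral.integral_const_mul, he, he]
  linear_combination (Complex.I / (2 * κ) * Complex.exp (-(Complex.I * κ * t))) * hint

/-- The effective field satisfies the Lippmann–Schwinger equation
`u_eff(t) − M ∫₀^T (i/(2κ)) e^{iκ|t−s|} u_eff(s) ds = e^{iκt}` for every `t ∈ ℝ`. -/
theorem stmt7 (κ M T : ℝ) (hκ : 0 < κ) (hM : 0 < M) (hT : 0 < T) :
    ∀ t : ℝ,
      ueff κ M T t - (M : ℂ) * ∫ s in (0 : ℝ)..T,
          Complex.I / (2 * κ) * Complex.exp (Complex.I * κ * |t - s|) * ueff κ M T s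
        = Complex.exp (Complex.I * κ * t) := by
  intro t
  have hκ' : (κ : ℂ) ≠ 0 := by exact_mod_cast hκ.ne'
  have hI : Complex.I / (2 * κ) * (2 * Complex.I * κ) = -1 := by
    field_simp
    exact Complex.I_sq
  have hu : ∫ s in (0 : ℝ)..T,
      Complex.I / (2 * κ) * Complex.exp (Complex.I * κ * |t - s|) * ueff κ M T s =
      ∫ s in (0 : ℝ)..T,
        Complex.I / (2 * κ) * Complex.exp (Complex.I * κ * |t - s|) * slabField κ M T s := by
    refine intervalIntegral.integral_congr fun s hs => ?_
    rw [Set.uIcc_of_le hT.le] at hs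
    simp only [ueff, slabField, if_neg hs.1.not_gt, if_pos hs.2]
  have h0 := slabFieldDeriv_zero κ M T hκ hM
  have hR := slabFieldDeriv_right κ M T
  rw [hu]
  rcases lt_or_ge t 0 with ht | ht
  · have h0' : slabFieldDeriv κ M T 0 - Complex.I * κ * slabField κ M T 0 =
        -(2 * Complex.I * κ) * C2coef κ M T := by
      linear_combination h0 - 2 * Complex.I * κ * slabField_zero κ M T hκ hM
    rw [integral_greens_of_le κ M T 0 T t hM hT.le ht.le, hR, h0', ueff, if_pos ht,
      Complex.ofReal_zero, zero_sub, mul_neg]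
    linear_combination (C2coef κ M T * Complex.exp (-(Complex.I * κ * t))) * hI
  rcases le_or_gt t T with htT | htT
  · have hcont := continuous_slabField κ M T
    have hint (a b : ℝ) : IntervalIntegrable (fun s : ℝ =>
        Complex.I / (2 * κ) * Complex.exp (Complex.I * κ * |t - s|) * slabField κ M T s)
        volume a b :=
      Continuous.intervalIntegrable (by fun_prop) _ _
    rw [← intervalIntegral.integral_add_adjacent_intervals (hint 0 t) (hint t T), mul_add,
      integral_greens_of_ge κ M T 0 t t hM ht le_rfl,
      integral_greens_of_le κ M T t T t hM htT le_rfl, hR, h0, ueff, if_neg ht.not_gt,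
      if_pos htT, ← slabField, sub_self, mul_zero, Complex.exp_zero, Complex.ofReal_zero, sub_zero]
    linear_combination (slabField κ M T t - Complex.exp (Complex.I * κ * t)) * hI
  · have hR' : slabFieldDeriv κ M T T + Complex.I * κ * slabField κ M T T =
        2 * Complex.I * κ * (C5coef κ M T * Complex.exp (Complex.I * κ * T)) := by
      linear_combination hR + 2 * Complex.I * κ * slabField_right κ M T
    have he : Complex.exp (Complex.I * κ * (t - T)) * Complex.exp (Complex.I * κ * T) =
        Complex.exp (Complex.I * κ * t) := by
      rw [← Complex.exp_add]
      ring_nf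
    rw [integral_greens_of_ge κ M T 0 T t hM hT.le htT.le, h0, hR', ueff,
      if_neg ht.not_gt, if_neg htT.not_ge, Complex.ofReal_zero, sub_zero]
    linear_combination (C5coef κ M T * Complex.exp (Complex.I * κ * (t - T)) *
      Complex.exp (Complex.I * κ * T) - Complex.exp (Complex.I * κ * t)) * hI -
      C5coef κ M T * he
end

section
/- Let κ>0, M>0, T>0, λ := √(κ²+M), and suppose sin(λT) ≠ 0. Then the transmission coefficient satisfies |C₅| ≤ 2κλ / ((λ²+κ²)|sin(λT)|) and the reflection coefficient satisfies |C₂ + 1| ≤ 2κ / (√(λ²+κ²)·|sin(λT)|). In particular, if |sin(λT)| ≥ σ > 0 is kept bounded away from zero while λ → ∞, then C₅ → 0 and C₂ → −1 (full reflection). -/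
/-- Trigonometric form of the denominator. -/
lemma Dcoef_eq (κ M T : ℝ) :
    Dcoef κ M T = ((4 * κ * lamEff κ M * Real.cos (lamEff κ M * T) : ℝ) : ℂ) +
      ((-(2 * (lamEff κ M ^ 2 + κ ^ 2) * Real.sin (lamEff κ M * T)) : ℝ) : ℂ) * Complex.I := by
  have h1 : Complex.I * lamEff κ M * T = ((lamEff κ M * T : ℝ) : ℂ) * Complex.I := by
    push_cast; ring
  rw [Dcoef, h1, ← neg_mul, Complex.exp_mul_I, Complex.exp_mul_I, Complex.cos_neg,
    Complex.sin_neg]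
  push_cast
  ring

lemma le_norm_Dcoef (κ M T : ℝ) :
    2 * ((lamEff κ M ^ 2 + κ ^ 2) * |Real.sin (lamEff κ M * T)|) ≤ ‖Dcoef κ M T‖ := by
  have h := Complex.abs_im_le_norm (Dcoef κ M T)
  have him : (Dcoef κ M T).im =
      -(2 * (lamEff κ M ^ 2 + κ ^ 2) * Real.sin (lamEff κ M * T)) := by
    rw [Dcoef_eq, ← Complex.mk_eq_add_mul_I]
  rw [him, abs_neg, abs_mul, abs_of_nonneg (by positivity)] at h
  linarith

lemma norm_C5coef_le {κ M T : ℝ} (hκ : 0 < κ) (hsin : Real.sin (lamEff κ M * T) ≠ 0) :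
    ‖C5coef κ M T‖ ≤
      2 * κ * lamEff κ M / ((lamEff κ M ^ 2 + κ ^ 2) * |Real.sin (lamEff κ M * T)|) := by
  have hl : 0 ≤ lamEff κ M := Real.sqrt_nonneg _
  have hs : 0 < |Real.sin (lamEff κ M * T)| := abs_pos.mpr hsin
  have h1 : Complex.I * κ * T = ((κ * T : ℝ) : ℂ) * Complex.I := by push_cast; ring
  have hexp : ‖Complex.exp (-(Complex.I * κ * T))‖ = 1 := by
    rw [h1, ← neg_mul, ← Complex.ofReal_neg, Complex.norm_exp_ofReal_mul_I]
  rw [C5coef, norm_div, norm_mul, hexp, mul_one, Complex.norm_real,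
    Real.norm_of_nonneg (by positivity)]
  calc 4 * κ * lamEff κ M / ‖Dcoef κ M T‖
      ≤ 4 * κ * lamEff κ M /
          (2 * ((lamEff κ M ^ 2 + κ ^ 2) * |Real.sin (lamEff κ M * T)|)) := by
        gcongr
        exact le_norm_Dcoef κ M T
    _ = _ := by
        field_simp
        ring

lemma C2coef_add_one {κ M T : ℝ} (hD : Dcoef κ M T ≠ 0) :
    C2coef κ M T + 1 = ((4 * κ : ℝ) : ℂ) *
      (((lamEff κ M * Real.cos (lamEff κ M * T) : ℝ) : ℂ) +
        ((-(κ * Real.sin (lamEff κ M * T)) : ℝ) : ℂ) * Complex.I) / Dcoef κ M T := by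
  have h1 : Complex.I * lamEff κ M * T = ((lamEff κ M * T : ℝ) : ℂ) * Complex.I := by
    push_cast; ring
  rw [C2coef, div_add_one hD]
  congr 1
  rw [Dcoef_eq, h1, ← neg_mul, Complex.exp_mul_I, Complex.exp_mul_I, Complex.cos_neg,
    Complex.sin_neg]
  push_cast
  ring

lemma norm_C2coef_add_one_le {κ M T : ℝ} (hκ : 0 < κ)
    (hsin : Real.sin (lamEff κ M * T) ≠ 0) :
    ‖C2coef κ M T + 1‖ ≤
      2 * κ / (Real.sqrt (lamEff κ M ^ 2 + κ ^ 2) * |Real.sin (lamEff κ M * T)|) := by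
  have hs : 0 < |Real.sin (lamEff κ M * T)| := abs_pos.mpr hsin
  have hD' := le_norm_Dcoef κ M T
  have hD : Dcoef κ M T ≠ 0 := norm_pos_iff.mp (lt_of_lt_of_le (by positivity) hD')
  have hR : 0 < Real.sqrt (lamEff κ M ^ 2 + κ ^ 2) := Real.sqrt_pos.mpr (by positivity)
  have hR2 : Real.sqrt (lamEff κ M ^ 2 + κ ^ 2) ^ 2 = lamEff κ M ^ 2 + κ ^ 2 :=
    Real.sq_sqrt (by positivity)
  have hN : Real.sqrt ((lamEff κ M * Real.cos (lamEff κ M * T)) ^ 2 +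
      (-(κ * Real.sin (lamEff κ M * T))) ^ 2) ≤ Real.sqrt (lamEff κ M ^ 2 + κ ^ 2) := by
    rw [neg_sq, mul_pow, mul_pow]
    exact Real.sqrt_le_sqrt (add_le_add
      (mul_le_of_le_one_right (sq_nonneg _) (Real.cos_sq_le_one _))
      (mul_le_of_le_one_right (sq_nonneg _) (Real.sin_sq_le_one _)))
  rw [C2coef_add_one hD, norm_div, norm_mul, Complex.norm_real,
    Real.norm_of_nonneg (by positivity), Complex.norm_add_mul_I]
  calc _ ≤ 4 * κ * Real.sqrt (lamEff κ M ^ 2 + κ ^ 2) /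
          (2 * (Real.sqrt (lamEff κ M ^ 2 + κ ^ 2) ^ 2 * |Real.sin (lamEff κ M * T)|)) := by
        rw [hR2]
        gcongr 4 * κ * ?_ / ?_
    _ = _ := by
        field_simp
        ring

/-- If `sin(λT) ≠ 0`, then `|C₅| ≤ 2κλ/((λ²+κ²)|sin(λT)|)` and
`|C₂ + 1| ≤ 2κ/(√(λ²+κ²)|sin(λT)|)`. In particular, if `|sin(λT)| ≥ σ > 0` is kept bounded
away from zero while `λ → ∞` (i.e. `M → ∞`), then `C₅ → 0` and `C₂ → −1` (full reflection). -/
theorem stmt11 (κ M T : ℝ) (hκ : 0 < κ) (hM : 0 < M) (hT : 0 < T)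
    (hsin : Real.sin (lamEff κ M * T) ≠ 0) :
    ‖C5coef κ M T‖ ≤
        2 * κ * lamEff κ M / ((lamEff κ M ^ 2 + κ ^ 2) * |Real.sin (lamEff κ M * T)|) ∧
    ‖C2coef κ M T + 1‖ ≤
        2 * κ / (Real.sqrt (lamEff κ M ^ 2 + κ ^ 2) * |Real.sin (lamEff κ M * T)|) ∧
    ∀ σ > (0 : ℝ), ∀ ε > (0 : ℝ), ∃ M₀ : ℝ, ∀ M' ≥ M₀,
      σ ≤ |Real.sin (lamEff κ M' * T)| →
      ‖C5coef κ M' T‖ ≤ ε ∧ ‖C2coef κ M' T + 1‖ ≤ ε := by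
  refine ⟨norm_C5coef_le hκ hsin, norm_C2coef_add_one_le hκ hsin, fun σ hσ ε hε =>
    ⟨(2 * κ / (σ * ε)) ^ 2, fun M' hM' hs => ?_⟩⟩
  have hsin' : Real.sin (lamEff κ M' * T) ≠ 0 := abs_pos.mp (hσ.trans_le hs)
  have hlam : 2 * κ / (σ * ε) ≤ lamEff κ M' :=
    Real.le_sqrt_of_sq_le (by nlinarith [sq_nonneg κ])
  have hpos : 0 < lamEff κ M' := lt_of_lt_of_le (by positivity) hlam
  have hbound : 2 * κ / (lamEff κ M' * σ) ≤ ε := by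
    rw [div_le_iff₀ (by positivity)] at hlam ⊢
    linarith
  refine ⟨(norm_C5coef_le hκ hsin').trans (le_trans ?_ hbound),
    (norm_C2coef_add_one_le hκ hsin').trans (le_trans ?_ hbound)⟩
  · calc _ ≤ 2 * κ * lamEff κ M' / (lamEff κ M' ^ 2 * σ) := by
          gcongr
          exact le_add_of_nonneg_right (sq_nonneg κ)
      _ = _ := by field_simp
  · gcongr
    exact Real.le_sqrt_of_sq_le (le_add_of_nonneg_right (sq_nonneg κ))
end
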